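/- Let d ≥ 1 and let 1 < p, p₁, p₂ < ∞ with 1/p = 1/p₁ + 1/p₂. Then there exists a constant C > 0, independent of τ, such that for every τ ≥ 0 and all Schwartz functions F₀, G₀ on ℝ^d, setting f := e^{−τΛ₁}F₀ and g := e^{−τΛ₁}G₀, one has ‖e^{τΛ₁}(fg)‖_{L^p(ℝ^d)} ≤ C·‖F₀‖_{L^{p₁}(ℝ^d)}·‖G₀‖_{L^{p₂}(ℝ^d)}. -/

import Mathlib

open MeasureTheory SchwartzMap Real
open scoped FourierTransform ENNReal NNReal

noncomputable section

abbrev Rd (d : ℕ) := EuclideanSpace ℝ (Fin d)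

/-- Gevrey multiplier e^{τΛ₁} with symbol e^{τ|ξ|₁}, |ξ|₁ = ∑ᵢ|ξᵢ|. -/
def expL1 (d : ℕ) (τ : ℝ) (f : Rd d → ℂ) : Rd d → ℂ :=
  𝓕⁻ fun ξ => (Real.exp (τ * ∑ i, |ξ i|) : ℂ) * 𝓕 f ξ

open Filter Topology Set

/-! ### A smooth superharmonic function on the plane -/

namespace RieszFunctional

/-- The function `(δ + |w|²)^r - δ^r - c ((δ + (re w)²)^r - δ^r)`. -/
def val (δ r c : ℝ) (w : ℂ) : ℝ :=
  (δ + (w.re ^ 2 + w.im ^ 2)) ^ r - δ ^ r - c * ((δ + w.re ^ 2) ^ r - δ ^ r)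

/-- The derivative of `val δ r c` along a curve through `w` with velocity `w₁`. -/
def deriv₁ (δ r c : ℝ) (w w₁ : ℂ) : ℝ :=
  2 * r * ((δ + (w.re ^ 2 + w.im ^ 2)) ^ (r - 1) * (w.re * w₁.re + w.im * w₁.im)
    - c * ((δ + w.re ^ 2) ^ (r - 1) * (w.re * w₁.re)))

/-- The second derivative of `val δ r c` along a curve through `w` with velocity `w₁` and
acceleration `w₂`. -/
def deriv₂ (δ r c : ℝ) (w w₁ w₂ : ℂ) : ℝ :=
  2 * r * (2 * (r - 1) * (δ + (w.re ^ 2 + w.im ^ 2)) ^ (r - 2)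
        * (w.re * w₁.re + w.im * w₁.im) ^ 2
      + (δ + (w.re ^ 2 + w.im ^ 2)) ^ (r - 1)
        * (w₁.re ^ 2 + w₁.im ^ 2 + w.re * w₂.re + w.im * w₂.im)
    - c * (2 * (r - 1) * (δ + w.re ^ 2) ^ (r - 2) * (w.re * w₁.re) ^ 2
      + (δ + w.re ^ 2) ^ (r - 1) * (w₁.re ^ 2 + w.re * w₂.re)))

variable {δ r c : ℝ}

lemma hasDerivAt_re {γ : ℝ → ℂ} {γ' : ℂ} {t : ℝ} (h : HasDerivAt γ γ' t) :
    HasDerivAt (fun t => (γ t).re) γ'.re t :=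
  Complex.reCLM.hasFDerivAt.comp_hasDerivAt t h

lemma hasDerivAt_im {γ : ℝ → ℂ} {γ' : ℂ} {t : ℝ} (h : HasDerivAt γ γ' t) :
    HasDerivAt (fun t => (γ t).im) γ'.im t :=
  Complex.imCLM.hasFDerivAt.comp_hasDerivAt t h

lemma hasDerivAt_val (hδ : 0 < δ) {γ : ℝ → ℂ} {γ' : ℂ} {t : ℝ} (h : HasDerivAt γ γ' t) :
    HasDerivAt (fun t => val δ r c (γ t)) (deriv₁ δ r c (γ t) γ') t := by
  have hu := hasDerivAt_re h
  have hv := hasDerivAt_im h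
  have hP := (((hu.pow 2).add (hv.pow 2)).const_add δ).rpow_const (p := r)
    (Or.inl (by simp only [Pi.add_apply, Pi.pow_apply]; positivity))
  have hQ := ((hu.pow 2).const_add δ).rpow_const (p := r)
    (Or.inl (by simp only [Pi.pow_apply]; positivity))
  refine ((hP.sub_const (δ ^ r)).sub ((hQ.sub_const (δ ^ r)).const_mul c)).congr_deriv ?_
  simp only [deriv₁, Pi.add_apply, Pi.pow_apply]
  ring

lemma hasDerivAt_deriv₁ (hδ : 0 < δ) {γ γ₁ : ℝ → ℂ} {γ₂ : ℂ} {t : ℝ}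
    (h : HasDerivAt γ (γ₁ t) t) (h₁ : HasDerivAt γ₁ γ₂ t) :
    HasDerivAt (fun t => deriv₁ δ r c (γ t) (γ₁ t)) (deriv₂ δ r c (γ t) (γ₁ t) γ₂) t := by
  have hu := hasDerivAt_re h
  have hv := hasDerivAt_im h
  have hu₁ := hasDerivAt_re h₁
  have hv₁ := hasDerivAt_im h₁
  have hP := (((hu.pow 2).add (hv.pow 2)).const_add δ).rpow_const (p := r - 1)
    (Or.inl (by simp only [Pi.add_apply, Pi.pow_apply]; positivity))
  have hQ := ((hu.pow 2).const_add δ).rpow_const (p := r - 1)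
    (Or.inl (by simp only [Pi.pow_apply]; positivity))
  refine (((hP.mul ((hu.mul hu₁).add (hv.mul hv₁))).sub
    ((hQ.mul (hu.mul hu₁)).const_mul c)).const_mul (2 * r)).congr_deriv ?_
  simp only [deriv₂, Pi.add_apply, Pi.pow_apply, Pi.mul_apply, show r - 1 - 1 = r - 2 by ring]
  ring

lemma deriv₂_add_deriv₂_I_mul_nonpos (hδ : 0 < δ) (hr : 1 / 2 < r) (hr' : r ≤ 1)
    (w w₁ w₂ : ℂ) :
    deriv₂ δ r (2 / (2 * r - 1)) w w₁ w₂
      + deriv₂ δ r (2 / (2 * r - 1)) w (Complex.I * w₁) (-w₂) ≤ 0 := by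
  obtain ⟨u, v⟩ := w
  obtain ⟨a, b⟩ := w₁
  obtain ⟨e, f⟩ := w₂
  simp only [deriv₂, Complex.mul_re, Complex.mul_im, Complex.I_re, Complex.I_im, Complex.neg_re,
    Complex.neg_im]
  set c := 2 / (2 * r - 1) with hc
  have hcr : c * (2 * r - 1) = 2 := by rw [hc]; field_simp [show 2 * r - 1 ≠ 0 by linarith]
  have hc0 : 0 < c := div_pos two_pos (by linarith)
  set P := δ + (u ^ 2 + v ^ 2) with hP
  set Q := δ + u ^ 2 with hQ
  have hP0 : 0 < P := by positivity
  have hQ0 : 0 < Q := by positivity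
  have hPQ : P ^ (r - 1) ≤ Q ^ (r - 1) :=
    Real.rpow_le_rpow_of_nonpos hQ0 (by nlinarith [sq_nonneg v]) (by linarith)
  have hP2 : P ^ (r - 1) = P ^ (r - 2) * P := by
    rw [← Real.rpow_add_one hP0.ne']; ring_nf
  have hQ2 : Q ^ (r - 1) = Q ^ (r - 2) * Q := by
    rw [← Real.rpow_add_one hQ0.ne']; ring_nf
  have hp2 : 0 < P ^ (r - 2) := Real.rpow_pos_of_pos hP0 _
  have hq2 : 0 < Q ^ (r - 2) := Real.rpow_pos_of_pos hQ0 _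
  have key : 2 * (r - 1) * P ^ (r - 2) * (u ^ 2 + v ^ 2) + 2 * P ^ (r - 1)
      - c * (2 * (r - 1) * Q ^ (r - 2) * u ^ 2 + Q ^ (r - 1)) ≤ 0 := by
    have h1 : 2 * (r - 1) * P ^ (r - 2) * (u ^ 2 + v ^ 2) ≤ 0 := by
      have : 0 ≤ (1 - r) * (P ^ (r - 2) * (u ^ 2 + v ^ 2)) :=
        mul_nonneg (by linarith) (by positivity)
      nlinarith
    have h2 : (2 * r - 1) * Q ^ (r - 1) ≤ 2 * (r - 1) * Q ^ (r - 2) * u ^ 2 + Q ^ (r - 1) := by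
      have : 0 ≤ (1 - r) * (Q ^ (r - 2) * δ) := mul_nonneg (by linarith) (by positivity)
      rw [hQ2, hQ]
      rw [hQ] at this
      nlinarith
    have h3 := mul_le_mul_of_nonneg_left h2 hc0.le
    have h4 : c * ((2 * r - 1) * Q ^ (r - 1)) = 2 * Q ^ (r - 1) := by
      rw [← mul_assoc, hcr]
    linarith
  have hfac := mul_nonpos_of_nonneg_of_nonpos
    (show 0 ≤ 2 * r * (a ^ 2 + b ^ 2) by nlinarith [sq_nonneg a, sq_nonneg b]) key
  refine le_of_eq_of_le ?_ hfac
  ring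

lemma rpow_le_of_nonpos (hδ : 0 < δ) {x s : ℝ} (hx : 0 ≤ x) (hs : s ≤ 0) :
    (δ + x) ^ s ≤ δ ^ s :=
  Real.rpow_le_rpow_of_nonpos hδ (by linarith) hs

lemma abs_rpow_add_sub_le (hδ : 0 < δ) (hr : 0 < r) (hr' : r ≤ 1) {x : ℝ} (hx : 0 ≤ x) :
    |(δ + x) ^ r - δ ^ r| ≤ δ ^ (r - 1) * x := by
  have h0 : δ ^ r ≤ (δ + x) ^ r := Real.rpow_le_rpow hδ.le (by linarith) hr.le
  rw [abs_of_nonneg (by linarith)]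
  have h1 := rpow_le_of_nonpos hδ hx (show r - 1 ≤ 0 by linarith)
  have h2 : (δ + x) ^ r = (δ + x) ^ (r - 1) * (δ + x) := by
    rw [← Real.rpow_add_one (by positivity)]; ring_nf
  have h3 : δ ^ r = δ ^ (r - 1) * δ := by
    rw [← Real.rpow_add_one (by positivity)]; ring_nf
  rw [h2, h3]
  nlinarith

lemma abs_val_le (hδ : 0 < δ) (hr : 0 < r) (hr' : r ≤ 1) (hc : 0 ≤ c) (w : ℂ) :
    |val δ r c w| ≤ (1 + c) * δ ^ (r - 1) * ‖w‖ ^ 2 := by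
  have hn : ‖w‖ ^ 2 = w.re ^ 2 + w.im ^ 2 := by
    rw [← Complex.normSq_eq_norm_sq, Complex.normSq_apply]; ring
  have h1 := abs_rpow_add_sub_le hδ hr hr' (show 0 ≤ w.re ^ 2 + w.im ^ 2 by positivity)
  have h2 := abs_rpow_add_sub_le hδ hr hr' (show 0 ≤ w.re ^ 2 by positivity)
  have h3 : δ ^ (r - 1) * w.re ^ 2 ≤ δ ^ (r - 1) * (w.re ^ 2 + w.im ^ 2) := by
    gcongr; nlinarith [sq_nonneg w.im]
  refine (abs_sub _ _).trans ?_
  rw [abs_mul, abs_of_nonneg hc, hn]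
  nlinarith [mul_le_mul_of_nonneg_left (h2.trans h3) hc]

lemma abs_inner_le (w z : ℂ) : |w.re * z.re + w.im * z.im| ≤ ‖w‖ * ‖z‖ := by
  have : w.re * z.re + w.im * z.im = (starRingEnd ℂ w * z).re := by simp
  rw [this]
  refine (Complex.abs_re_le_norm _).trans ?_
  simp

lemma abs_re_mul_re_le (w z : ℂ) : |w.re * z.re| ≤ ‖w‖ * ‖z‖ := by
  rw [abs_mul]
  exact mul_le_mul (Complex.abs_re_le_norm _) (Complex.abs_re_le_norm _) (abs_nonneg _)
    (norm_nonneg _)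

lemma abs_deriv₁_le (hδ : 0 < δ) (hr : 0 < r) (hr' : r ≤ 1) (hc : 0 ≤ c) (w w₁ : ℂ) :
    |deriv₁ δ r c w w₁| ≤ 2 * r * (1 + c) * δ ^ (r - 1) * (‖w‖ * ‖w₁‖) := by
  have h1 := rpow_le_of_nonpos hδ (show 0 ≤ w.re ^ 2 + w.im ^ 2 by positivity)
    (show r - 1 ≤ 0 by linarith)
  have h2 := rpow_le_of_nonpos hδ (show 0 ≤ w.re ^ 2 by positivity)
    (show r - 1 ≤ 0 by linarith)
  have e1 : |(δ + (w.re ^ 2 + w.im ^ 2)) ^ (r - 1) * (w.re * w₁.re + w.im * w₁.im)|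
      ≤ δ ^ (r - 1) * (‖w‖ * ‖w₁‖) := by
    rw [abs_mul, abs_of_nonneg (by positivity)]
    exact mul_le_mul h1 (abs_inner_le _ _) (abs_nonneg _) (by positivity)
  have e2 : |(δ + w.re ^ 2) ^ (r - 1) * (w.re * w₁.re)| ≤ δ ^ (r - 1) * (‖w‖ * ‖w₁‖) := by
    rw [abs_mul, abs_of_nonneg (by positivity)]
    exact mul_le_mul h2 (abs_re_mul_re_le _ _) (abs_nonneg _) (by positivity)
  rw [deriv₁, abs_mul, abs_of_nonneg (by positivity : 0 ≤ 2 * r)]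
  have e3 := abs_sub ((δ + (w.re ^ 2 + w.im ^ 2)) ^ (r - 1) * (w.re * w₁.re + w.im * w₁.im))
    (c * ((δ + w.re ^ 2) ^ (r - 1) * (w.re * w₁.re)))
  rw [abs_mul c, abs_of_nonneg hc] at e3
  calc _ ≤ 2 * r * (δ ^ (r - 1) * (‖w‖ * ‖w₁‖) + c * (δ ^ (r - 1) * (‖w‖ * ‖w₁‖))) := by
        gcongr
        exact e3.trans (by gcongr)
    _ = _ := by ring

lemma abs_rpow_mul_sq_le (hδ : 0 < δ) (hr' : r ≤ 1) {s m k : ℝ} (hs : 0 ≤ s)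
    (hm : m ^ 2 ≤ s * k ^ 2) : (δ + s) ^ (r - 2) * m ^ 2 ≤ δ ^ (r - 1) * k ^ 2 := by
  have h1 := rpow_le_of_nonpos hδ hs (show r - 1 ≤ 0 by linarith)
  have h2 : (δ + s) ^ (r - 1) = (δ + s) ^ (r - 2) * (δ + s) := by
    rw [← Real.rpow_add_one (by positivity)]; ring_nf
  calc _ ≤ (δ + s) ^ (r - 2) * ((δ + s) * k ^ 2) := by
        gcongr; nlinarith [sq_nonneg k]
    _ = (δ + s) ^ (r - 1) * k ^ 2 := by rw [h2]; ring
    _ ≤ _ := by gcongr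

lemma abs_deriv₂_le (hδ : 0 < δ) (hr : 0 < r) (hr' : r ≤ 1) (hc : 0 ≤ c) (w w₁ w₂ : ℂ) :
    |deriv₂ δ r c w w₁ w₂| ≤
      2 * r * (1 + c) * δ ^ (r - 1) * (3 * ‖w₁‖ ^ 2 + ‖w‖ * ‖w₂‖) := by
  have hn (w : ℂ) : ‖w‖ ^ 2 = w.re ^ 2 + w.im ^ 2 := by
    rw [← Complex.normSq_eq_norm_sq, Complex.normSq_apply]; ring
  set D := δ ^ (r - 1)
  have hD : 0 < D := by positivity
  have h1 := rpow_le_of_nonpos hδ (show 0 ≤ w.re ^ 2 + w.im ^ 2 by positivity)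
    (show r - 1 ≤ 0 by linarith)
  have h2 := rpow_le_of_nonpos hδ (show 0 ≤ w.re ^ 2 by positivity)
    (show r - 1 ≤ 0 by linarith)
  have a1 : |2 * (r - 1)| ≤ 2 := by rw [abs_le]; constructor <;> linarith
  have e1 : |2 * (r - 1) * (δ + (w.re ^ 2 + w.im ^ 2)) ^ (r - 2)
        * (w.re * w₁.re + w.im * w₁.im) ^ 2| ≤ 2 * (D * ‖w₁‖ ^ 2) := by
    rw [mul_assoc, abs_mul, abs_of_nonneg (by positivity : 0 ≤
      (δ + (w.re ^ 2 + w.im ^ 2)) ^ (r - 2) * (w.re * w₁.re + w.im * w₁.im) ^ 2)]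
    refine mul_le_mul a1 (abs_rpow_mul_sq_le hδ hr' (by positivity) ?_)
      (by positivity) (by norm_num)
    rw [← hn, ← mul_pow, ← sq_abs]
    gcongr
    exact abs_inner_le _ _
  have e2 : |2 * (r - 1) * (δ + w.re ^ 2) ^ (r - 2) * (w.re * w₁.re) ^ 2|
      ≤ 2 * (D * ‖w₁‖ ^ 2) := by
    rw [mul_assoc, abs_mul, abs_of_nonneg (by positivity : 0 ≤
      (δ + w.re ^ 2) ^ (r - 2) * (w.re * w₁.re) ^ 2)]
    refine mul_le_mul a1 (abs_rpow_mul_sq_le hδ hr' (by positivity) ?_)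
      (by positivity) (by norm_num)
    rw [mul_pow]
    refine mul_le_mul_of_nonneg_left ?_ (sq_nonneg _)
    rw [hn]; nlinarith [sq_nonneg w₁.im]
  have e3 : |(δ + (w.re ^ 2 + w.im ^ 2)) ^ (r - 1)
        * (w₁.re ^ 2 + w₁.im ^ 2 + w.re * w₂.re + w.im * w₂.im)|
      ≤ D * (‖w₁‖ ^ 2 + ‖w‖ * ‖w₂‖) := by
    rw [abs_mul, abs_of_nonneg (by positivity)]
    refine mul_le_mul h1 ?_ (abs_nonneg _) hD.le
    rw [← hn, add_assoc]
    refine (abs_add_le _ _).trans (add_le_add (abs_of_nonneg (by positivity)).le (abs_inner_le _ _))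
  have e4 : |(δ + w.re ^ 2) ^ (r - 1) * (w₁.re ^ 2 + w.re * w₂.re)|
      ≤ D * (‖w₁‖ ^ 2 + ‖w‖ * ‖w₂‖) := by
    rw [abs_mul, abs_of_nonneg (by positivity)]
    refine mul_le_mul h2 ?_ (abs_nonneg _) hD.le
    refine (abs_add_le _ _).trans (add_le_add ?_ (abs_re_mul_re_le _ _))
    rw [abs_of_nonneg (by positivity), hn]
    nlinarith [sq_nonneg w₁.im]
  rw [deriv₂, abs_mul, abs_of_nonneg (by positivity : 0 ≤ 2 * r)]
  calc _ ≤ 2 * r * ((2 * (D * ‖w₁‖ ^ 2) + D * (‖w₁‖ ^ 2 + ‖w‖ * ‖w₂‖))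
        + c * (2 * (D * ‖w₁‖ ^ 2) + D * (‖w₁‖ ^ 2 + ‖w‖ * ‖w₂‖))) := by
        gcongr
        refine (abs_sub _ _).trans (add_le_add
          ((abs_add_le _ _).trans (add_le_add e1 e3)) ?_)
        rw [abs_mul, abs_of_nonneg hc]
        gcongr
        exact (abs_add_le _ _).trans (add_le_add e2 e4)
    _ = _ := by ring

lemma aemeasurable_deriv₂ {Ω : Type*} [MeasurableSpace Ω] {μ : Measure Ω} {w w₁ w₂ : Ω → ℂ}
    (hw : AEMeasurable w μ) (hw₁ : AEMeasurable w₁ μ) (hw₂ : AEMeasurable w₂ μ) :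
    AEMeasurable (fun p => deriv₂ δ r c (w p) (w₁ p) (w₂ p)) μ := by
  have hre {f : Ω → ℂ} (hf : AEMeasurable f μ) : AEMeasurable (fun p => (f p).re) μ :=
    Complex.measurable_re.comp_aemeasurable hf
  have him {f : Ω → ℂ} (hf : AEMeasurable f μ) : AEMeasurable (fun p => (f p).im) μ :=
    Complex.measurable_im.comp_aemeasurable hf
  have h1 := hre hw
  have h2 := him hw
  have h3 := hre hw₁
  have h4 := him hw₁
  have h5 := hre hw₂
  have h6 := him hw₂
  unfold deriv₂
  fun_prop

end RieszFunctional

lemma hasDerivAt_comp_horizontal {F : ℂ → ℂ} {F' : ℂ} {x y : ℝ}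
    (h : HasDerivAt F F' (x + y * Complex.I)) :
    HasDerivAt (fun x : ℝ => F (x + y * Complex.I)) F' x := by
  have h1 : HasDerivAt (fun x : ℝ => (x : ℂ) + y * Complex.I) 1 x :=
    (Complex.ofRealCLM.hasDerivAt (x := x)).add_const _
  exact (h.comp x h1).congr_deriv (mul_one _)

lemma hasDerivAt_comp_vertical {F : ℂ → ℂ} {F' : ℂ} {x y : ℝ}
    (h : HasDerivAt F F' (x + y * Complex.I)) :
    HasDerivAt (fun y : ℝ => F (x + y * Complex.I)) (Complex.I * F') y := by
  have h1 : HasDerivAt (fun y : ℝ => (x : ℂ) + y * Complex.I) Complex.I y := by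
    simpa using ((Complex.ofRealCLM.hasDerivAt (x := y)).mul_const Complex.I).const_add (x : ℂ)
  exact (h.comp y h1).congr_deriv (mul_comm _ _)

lemma one_add_abs_le_left (x y : ℝ) : 1 + |x| ≤ 1 + ‖(x + y * Complex.I : ℂ)‖ := by
  have := Complex.abs_re_le_norm (x + y * Complex.I : ℂ)
  simp at this; linarith

lemma one_add_abs_le_right (x y : ℝ) : 1 + |y| ≤ 1 + ‖(x + y * Complex.I : ℂ)‖ := by
  have := Complex.abs_im_le_norm (x + y * Complex.I : ℂ)
  simp at this; linarith

lemma integrable_one_add_abs_rpow {s : ℝ} (hs : 1 < s) :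
    Integrable (fun x : ℝ => (1 + |x|) ^ (-s)) := by
  simpa using integrable_one_add_norm (E := ℝ) (μ := volume) (r := s) (by simpa using hs)

lemma one_div_one_add_norm_pow_three_le (x y : ℝ) :
    1 / (1 + ‖(x + y * Complex.I : ℂ)‖) ^ 3 ≤
      (1 + |x|) ^ (-(3 / 2) : ℝ) * (1 + |y|) ^ (-(3 / 2) : ℝ) := by
  set N := 1 + ‖(x + y * Complex.I : ℂ)‖ with hN
  have hN0 : 0 < N := by positivity
  have h : 1 / N ^ 3 = N ^ (-(3 / 2) : ℝ) * N ^ (-(3 / 2) : ℝ) := by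
    rw [← Real.rpow_add hN0, ← Real.rpow_natCast, one_div, ← Real.rpow_neg hN0.le]
    norm_num
  rw [h]
  exact mul_le_mul
    (Real.rpow_le_rpow_of_nonpos (by positivity) (one_add_abs_le_left x y) (by norm_num))
    (Real.rpow_le_rpow_of_nonpos (by positivity) (one_add_abs_le_right x y) (by norm_num))
    (by positivity) (by positivity)

lemma tendsto_inv_one_add_norm {l : Filter ℝ} {z : ℝ → ℂ} (h : Tendsto (fun t => ‖z t‖) l atTop) :
    Tendsto (fun t => 1 / (1 + ‖z t‖)) l (𝓝 0) := by
  simp only [one_div]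
  exact tendsto_inv_atTop_zero.comp (tendsto_atTop_add_const_left _ _ h)

open RieszFunctional in
set_option maxHeartbeats 1000000 in
/-- If `F` is holomorphic in the upper half plane with the decay of a Cauchy integral, then the
integral of the superharmonic functional of `F` along a horizontal line is nonpositive. -/
lemma integral_val_nonpos {F F₁ F₂ : ℂ → ℂ} {α C δ r : ℝ} (hα : 0 < α) (hδ : 0 < δ)
    (hr : 1 / 2 < r) (hr' : r ≤ 1)
    (hF : ∀ z : ℂ, 0 < z.im → HasDerivAt F (F₁ z) z)
    (hF₁ : ∀ z : ℂ, 0 < z.im → HasDerivAt F₁ (F₂ z) z)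
    (hF₂ : ContinuousOn F₂ {z : ℂ | 0 < z.im})
    (bF : ∀ z : ℂ, α ≤ z.im → ‖F z‖ ≤ C / (1 + ‖z‖))
    (bF₁ : ∀ z : ℂ, α ≤ z.im → ‖F₁ z‖ ≤ C / (1 + ‖z‖) ^ 2)
    (bF₂ : ∀ z : ℂ, α ≤ z.im → ‖F₂ z‖ ≤ C / (1 + ‖z‖) ^ 3) :
    ∫ x : ℝ, val δ r (2 / (2 * r - 1)) (F (x + α * Complex.I)) ≤ 0 := by
  set c := 2 / (2 * r - 1) with hc
  have hc0 : 0 ≤ c := (div_pos two_pos (by linarith)).le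
  have hr0 : 0 < r := by linarith
  have hC : 0 ≤ C := by
    have := (norm_nonneg _).trans (bF (α * Complex.I) (by simp))
    by_contra hneg
    exact absurd this (not_le.2 (div_neg_of_neg_of_pos (not_le.1 hneg) (by positivity)))
  set K := 2 * r * (1 + c) * δ ^ (r - 1) with hK
  have hK0 : 0 ≤ K := by positivity
  have im_eq (x y : ℝ) : (x + y * Complex.I : ℂ).im = y := by simp
  have bD₁ : ∀ (x y : ℝ) (a : ℂ), ‖a‖ = 1 → α ≤ y →
      |deriv₁ δ r c (F (x + y * Complex.I)) (a * F₁ (x + y * Complex.I))| ≤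
        K * C ^ 2 * (1 / (1 + ‖(x + y * Complex.I : ℂ)‖) ^ 3) := by
    intro x y a ha hy
    refine (abs_deriv₁_le hδ hr0 hr' hc0 _ _).trans ?_
    rw [norm_mul, ha, one_mul, mul_assoc K]
    refine mul_le_mul_of_nonneg_left ?_ hK0
    calc _ ≤ C / (1 + ‖(x + y * Complex.I : ℂ)‖) * (C / (1 + ‖(x + y * Complex.I : ℂ)‖) ^ 2) :=
          mul_le_mul (bF _ (by simpa using hy)) (bF₁ _ (by simpa using hy)) (norm_nonneg _)
            (by positivity)
      _ = _ := by field_simp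
  have bD₂ : ∀ (x y : ℝ) (a b : ℂ), ‖a‖ = 1 → ‖b‖ = 1 → α ≤ y →
      |deriv₂ δ r c (F (x + y * Complex.I)) (a * F₁ (x + y * Complex.I))
        (b * F₂ (x + y * Complex.I))| ≤
        4 * K * C ^ 2 * (1 / (1 + ‖(x + y * Complex.I : ℂ)‖) ^ 4) := by
    intro x y a b ha hb hy
    refine (abs_deriv₂_le hδ hr0 hr' hc0 _ _ _).trans ?_
    rw [norm_mul, norm_mul, ha, hb, one_mul, one_mul]
    have h0 := bF (x + y * Complex.I) (by simpa using hy)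
    have h1 := bF₁ (x + y * Complex.I) (by simpa using hy)
    have h2 := bF₂ (x + y * Complex.I) (by simpa using hy)
    set N := 1 + ‖(x + y * Complex.I : ℂ)‖
    have hN : 0 < N := by positivity
    calc _ ≤ K * (3 * (C / N ^ 2) ^ 2 + C / N * (C / N ^ 3)) := by gcongr
      _ = _ := by field_simp; ring
  -- the two second derivatives
  set A : ℝ × ℝ → ℝ := fun p => (p.2 - α) * deriv₂ δ r c (F (p.1 + p.2 * Complex.I))
    (1 * F₁ (p.1 + p.2 * Complex.I)) (1 * F₂ (p.1 + p.2 * Complex.I)) with hA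
  set B : ℝ × ℝ → ℝ := fun p => (p.2 - α) * deriv₂ δ r c (F (p.1 + p.2 * Complex.I))
    (Complex.I * F₁ (p.1 + p.2 * Complex.I)) (-1 * F₂ (p.1 + p.2 * Complex.I)) with hB
  set ν := (volume : Measure ℝ).prod (volume.restrict (Ioi α)) with hν
  have hae : ∀ᵐ p ∂ν, α < p.2 := by
    have : ∀ᵐ y ∂(volume.restrict (Ioi α)), α < y := ae_restrict_mem measurableSet_Ioi
    exact Measure.quasiMeasurePreserving_snd.ae this
  have cF : ContinuousOn F {z : ℂ | 0 < z.im} := fun z hz => (hF z hz).continuousAt.continuousWithinAt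
  have cF₁ : ContinuousOn F₁ {z : ℂ | 0 < z.im} :=
    fun z hz => (hF₁ z hz).continuousAt.continuousWithinAt
  have hmeas : ∀ G : ℂ → ℂ, ContinuousOn G {z : ℂ | 0 < z.im} →
      AEMeasurable (fun p : ℝ × ℝ => G (p.1 + p.2 * Complex.I)) ν := by
    intro G hG
    have h1 : ContinuousOn (fun p : ℝ × ℝ => G (p.1 + p.2 * Complex.I)) (univ ×ˢ Ioi α) := by
      refine hG.comp (by fun_prop) ?_
      rintro ⟨x, y⟩ ⟨-, hy⟩
      simpa using hα.trans hy
    have h2 : ν = (volume.prod volume).restrict (univ ×ˢ Ioi α) := by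
      rw [← Measure.prod_restrict, Measure.restrict_univ]
    rw [h2]
    exact h1.aemeasurable (MeasurableSet.univ.prod measurableSet_Ioi)
  have hVint : ∀ a b : ℂ, ‖a‖ = 1 → ‖b‖ = 1 → Integrable (fun p : ℝ × ℝ => (p.2 - α) *
      deriv₂ δ r c (F (p.1 + p.2 * Complex.I)) (a * F₁ (p.1 + p.2 * Complex.I))
        (b * F₂ (p.1 + p.2 * Complex.I))) ν := by
    intro a b ha hb
    have hdom : Integrable (fun p : ℝ × ℝ => 4 * K * C ^ 2 *
        ((1 + |p.1|) ^ (-(3 / 2) : ℝ) * (1 + |p.2|) ^ (-(3 / 2) : ℝ))) ν :=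
      ((integrable_one_add_abs_rpow (by norm_num)).mul_prod
        (integrable_one_add_abs_rpow (by norm_num)).restrict).const_mul _
    refine hdom.mono' ?_ ?_
    · refine AEMeasurable.aestronglyMeasurable ?_
      refine (by fun_prop : AEMeasurable (fun p : ℝ × ℝ => p.2 - α) ν).mul ?_
      exact aemeasurable_deriv₂ (hmeas F cF) ((hmeas F₁ cF₁).const_mul a)
        ((hmeas F₂ hF₂).const_mul b)
    · filter_upwards [hae] with p hp
      obtain ⟨x, y⟩ := p
      simp only at hp ⊢
      rw [Real.norm_eq_abs, abs_mul, abs_of_nonneg (by linarith : 0 ≤ y - α)]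
      have hyN : y - α ≤ 1 + ‖(x + y * Complex.I : ℂ)‖ := by
        have := one_add_abs_le_right x y
        have := le_abs_self y
        linarith
      have hb3 := one_div_one_add_norm_pow_three_le x y
      have hb2 := bD₂ x y a b ha hb hp.le
      set N := 1 + ‖(x + y * Complex.I : ℂ)‖
      have hN : 0 < N := by positivity
      calc _ ≤ N * (4 * K * C ^ 2 * (1 / N ^ 4)) := by
            gcongr
        _ = 4 * K * C ^ 2 * (1 / N ^ 3) := by field_simp
        _ ≤ _ := by gcongr
  have hAint : Integrable A ν := hVint 1 1 (by simp) (by simp)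
  have hBint : Integrable B ν := hVint Complex.I (-1) (by simp) (by simp)
  have hAzero : ∫ p, A p ∂ν = 0 := by
    rw [integral_prod_symm A hAint]
    refine (setIntegral_congr_fun (g := fun _ => 0) measurableSet_Ioi ?_).trans (by simp)
    intro y hy
    simp only [hA]
    rw [integral_const_mul]
    have hy0 : 0 < y := hα.trans hy
    have hlim : ∀ l : Filter ℝ, Tendsto (fun x : ℝ => ‖x‖) l atTop →
        Tendsto (fun x : ℝ => deriv₁ δ r c (F (x + y * Complex.I))
          (1 * F₁ (x + y * Complex.I))) l (𝓝 0) := by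
      intro l hl
      have hz : Tendsto (fun x : ℝ => ‖(x + y * Complex.I : ℂ)‖) l atTop := by
        refine tendsto_atTop_mono (fun x => ?_) hl
        have := one_add_abs_le_left x y
        simp only [Real.norm_eq_abs]; linarith
      have h0 := ((tendsto_inv_one_add_norm hz).pow 3).const_mul (K * C ^ 2)
      simp only [zero_pow (show 3 ≠ 0 by norm_num), mul_zero] at h0
      refine squeeze_zero_norm (fun x => ?_) h0
      simpa using bD₁ x y 1 (by simp) (le_of_lt hy)
    have hderiv : ∀ x : ℝ, HasDerivAt (fun x : ℝ => deriv₁ δ r c (F (x + y * Complex.I))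
        (1 * F₁ (x + y * Complex.I))) (deriv₂ δ r c (F (x + y * Complex.I))
        (1 * F₁ (x + y * Complex.I)) (1 * F₂ (x + y * Complex.I))) x := by
      intro x
      simp only [one_mul]
      exact hasDerivAt_deriv₁ hδ
        (γ₁ := fun x : ℝ => F₁ (x + y * Complex.I))
        (hasDerivAt_comp_horizontal (hF _ (by simpa using hy0)))
        (hasDerivAt_comp_horizontal (hF₁ _ (by simpa using hy0)))
    have hi : Integrable (fun x : ℝ => deriv₂ δ r c (F (x + y * Complex.I))
        (1 * F₁ (x + y * Complex.I)) (1 * F₂ (x + y * Complex.I))) := by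
      refine ((integrable_one_add_abs_rpow (s := 4) (by norm_num)).const_mul
        (4 * K * C ^ 2)).mono' ?_ ?_
      · refine Measurable.aestronglyMeasurable ?_
        rw [show (fun x : ℝ => deriv₂ δ r c (F (x + y * Complex.I))
          (1 * F₁ (x + y * Complex.I)) (1 * F₂ (x + y * Complex.I))) = deriv _ from
          funext fun x => (hderiv x).deriv.symm]
        exact measurable_deriv _
      · refine ae_of_all _ fun x => ?_
        refine (bD₂ x y 1 1 (by simp) (by simp) (le_of_lt hy)).trans ?_
        gcongr
        rw [Real.rpow_neg (by positivity), one_div,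
          show (4 : ℝ) = ((4 : ℕ) : ℝ) by norm_num, Real.rpow_natCast]
        gcongr
        have := one_add_abs_le_left x y
        linarith
    rw [integral_of_hasDerivAt_of_tendsto hderiv hi (hlim _ (by simpa [Real.norm_eq_abs] using tendsto_abs_atBot_atTop))
      (hlim _ tendsto_norm_atTop_atTop)]
    simp
  have hBval : ∫ p, B p ∂ν = ∫ x : ℝ, val δ r c (F (x + α * Complex.I)) := by
    rw [integral_prod B hBint]
    refine integral_congr_ae ?_
    filter_upwards [hBint.prod_right_ae] with x hx
    have hz : Tendsto (fun y : ℝ => ‖(x + y * Complex.I : ℂ)‖) atTop atTop := by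
      refine tendsto_atTop_mono (fun y => ?_) tendsto_norm_atTop_atTop
      have := one_add_abs_le_right x y
      simp only [Real.norm_eq_abs]; linarith
    have hderiv : ∀ y ∈ Ici α, HasDerivAt (fun y : ℝ => (y - α) *
        deriv₁ δ r c (F (x + y * Complex.I)) (Complex.I * F₁ (x + y * Complex.I))
          - val δ r c (F (x + y * Complex.I))) (B (x, y)) y := by
      intro y hy
      have hy0 : 0 < y := hα.trans_le hy
      have h0 := hasDerivAt_comp_vertical (hF (x + y * Complex.I) (by simpa using hy0))
      have h1 := hasDerivAt_comp_vertical (hF₁ (x + y * Complex.I) (by simpa using hy0))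
      have h2 := hasDerivAt_deriv₁ (r := r) (c := c) hδ
        (γ₁ := fun y : ℝ => Complex.I * F₁ (x + y * Complex.I)) h0 (h1.const_mul Complex.I)
      have h3 := (((hasDerivAt_id y).sub_const α).mul h2).sub
        (hasDerivAt_val (r := r) (c := c) hδ h0)
      refine h3.congr_deriv ?_
      simp only [hB, id, one_mul]
      rw [← mul_assoc Complex.I, Complex.I_mul_I]
      ring
    have hlim : Tendsto (fun y : ℝ => (y - α) *
        deriv₁ δ r c (F (x + y * Complex.I)) (Complex.I * F₁ (x + y * Complex.I))
          - val δ r c (F (x + y * Complex.I))) atTop (𝓝 0) := by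
      have h0 := ((tendsto_inv_one_add_norm hz).pow 2).const_mul
        (K * C ^ 2 + (1 + c) * δ ^ (r - 1) * C ^ 2)
      simp only [zero_pow (show 2 ≠ 0 by norm_num), mul_zero] at h0
      refine squeeze_zero_norm' ?_ h0
      filter_upwards [eventually_ge_atTop α] with y hy
      have hyN : y - α ≤ 1 + ‖(x + y * Complex.I : ℂ)‖ := by
        have := one_add_abs_le_right x y
        have := le_abs_self y
        linarith
      have e1 := bD₁ x y Complex.I (by simp) hy
      have e2 := abs_val_le hδ hr0 hr' hc0 (F (x + y * Complex.I))
      have e3 := bF (x + y * Complex.I) (by simpa using hy)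
      set N := 1 + ‖(x + y * Complex.I : ℂ)‖
      have hN : 0 < N := by positivity
      refine (norm_sub_le _ _).trans ?_
      rw [norm_mul, Real.norm_eq_abs, Real.norm_eq_abs, Real.norm_eq_abs,
        abs_of_nonneg (by linarith : 0 ≤ y - α)]
      calc _ ≤ N * (K * C ^ 2 * (1 / N ^ 3)) + (1 + c) * δ ^ (r - 1) * (C / N) ^ 2 := by
            gcongr
            exact e2.trans (by gcongr)
        _ = _ := by field_simp
    rw [integral_Ioi_of_hasDerivAt_of_tendsto' hderiv hx hlim]
    simp
  have hsum : ∫ p, (A p + B p) ∂ν ≤ 0 := by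
    refine integral_nonpos_of_ae ?_
    filter_upwards [hae] with p hp
    have := deriv₂_add_deriv₂_I_mul_nonpos hδ hr hr' (F (p.1 + p.2 * Complex.I))
      (F₁ (p.1 + p.2 * Complex.I)) (F₂ (p.1 + p.2 * Complex.I))
    simp only [hA, hB, one_mul, neg_one_mul, Pi.zero_apply, ← mul_add]
    exact mul_nonpos_of_nonneg_of_nonpos (by linarith) this
  rwa [integral_add hAint hBint, hAzero, zero_add, hBval] at hsum

/-! ### Cauchy integrals -/

/-- The integral `∫ f(t) (z - t)⁻ⁿ dt`. -/
def cauchyPow (f : ℝ → ℂ) (n : ℕ) (z : ℂ) : ℂ := ∫ t, f t * ((z - t)⁻¹) ^ n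

lemma sub_ofReal_ne_zero {z : ℂ} (hz : 0 < z.im) (t : ℝ) : z - t ≠ 0 := by
  intro h
  have := congrArg Complex.im h
  simp at this
  exact hz.ne' this

lemma norm_inv_sub_ofReal_le {z : ℂ} {a : ℝ} (ha : 0 < a) (hz : a ≤ z.im) (t : ℝ) :
    ‖(z - t)⁻¹‖ ≤ a⁻¹ := by
  rw [norm_inv]
  refine inv_anti₀ ha (hz.trans ?_)
  have := Complex.abs_im_le_norm (z - t)
  simp at this
  exact (le_abs_self _).trans this

lemma measurable_inv_sub_ofReal (z : ℂ) : Measurable fun t : ℝ => (z - t)⁻¹ := by fun_prop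

lemma hasDerivAt_cauchyPow {f : ℝ → ℂ} (hf : Integrable f) (n : ℕ) {z : ℂ} (hz : 0 < z.im) :
    HasDerivAt (cauchyPow f n) (-n * cauchyPow f (n + 1) z) z := by
  have him : ∀ w ∈ Metric.ball z (z.im / 2), z.im / 2 ≤ w.im := by
    intro w hw
    rw [Metric.mem_ball, Complex.dist_eq] at hw
    have := (Complex.abs_im_le_norm (w - z)).trans hw.le
    rw [Complex.sub_im, abs_le] at this
    linarith
  have hh : 0 < z.im / 2 := by positivity
  have hmeas (w : ℂ) (m : ℕ) : AEStronglyMeasurable (fun t : ℝ => f t * ((w - t)⁻¹) ^ m) :=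
    hf.aestronglyMeasurable.mul ((measurable_inv_sub_ofReal w).pow_const m).aestronglyMeasurable
  have hb (w : ℂ) (hw : z.im / 2 ≤ w.im) (m : ℕ) (t : ℝ) :
      ‖f t * ((w - t)⁻¹) ^ m‖ ≤ ‖f t‖ * ((z.im / 2)⁻¹) ^ m := by
    rw [norm_mul, norm_pow]
    gcongr
    exact norm_inv_sub_ofReal_le hh hw t
  have := hasDerivAt_integral_of_dominated_loc_of_deriv_le
    (F := fun (w : ℂ) (t : ℝ) => f t * ((w - t)⁻¹) ^ n)
    (F' := fun (w : ℂ) (t : ℝ) => -n * (f t * ((w - t)⁻¹) ^ (n + 1)))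
    (bound := fun t => n * (‖f t‖ * ((z.im / 2)⁻¹) ^ (n + 1))) (μ := volume)
    (Metric.ball_mem_nhds z hh) (Eventually.of_forall fun w => hmeas w n)
    ((hf.norm.mul_const (((z.im / 2)⁻¹) ^ n)).mono' (hmeas z n)
      (ae_of_all _ fun t => hb z (by linarith) n t))
    ((hmeas z (n + 1)).const_mul _)
    (ae_of_all _ fun t w hw => ?_) ((hf.norm.mul_const _).const_mul _)
    (ae_of_all _ fun t w hw => ?_)
  · rw [integral_const_mul] at this
    exact this.2
  · rw [norm_mul, norm_neg, Complex.norm_natCast]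
    exact mul_le_mul_of_nonneg_left (hb w (him w hw) _ t) (by positivity)
  · have h0 := sub_ofReal_ne_zero (hh.trans_le (him w hw)) t
    have h1 := ((((hasDerivAt_id w).sub_const (t : ℂ)).inv h0).pow n).const_mul (f t)
    refine h1.congr_deriv ?_
    simp only [id, Pi.inv_apply]
    rcases n with _ | n
    · simp
    · simp only [Nat.add_sub_cancel]
      push_cast
      generalize w - (t : ℂ) = a
      ring

lemma norm_cauchyPow_le {f : ℝ → ℂ} {M R α : ℝ} (hM : ∀ t, ‖f t‖ ≤ M)
    (hR : ∀ t, t ∉ Icc (-R) R → f t = 0) (hR0 : 0 ≤ R) (hα : 0 < α) (n : ℕ) {z : ℂ}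
    (hz : α ≤ z.im) :
    ‖cauchyPow f n z‖ ≤ M * (1 + (R + 1) / α) ^ n * (2 * R) / (1 + ‖z‖) ^ n := by
  have hM0 : 0 ≤ M := (norm_nonneg _).trans (hM 0)
  have h1 : cauchyPow f n z = ∫ t in Icc (-R) R, f t * ((z - t)⁻¹) ^ n := by
    rw [cauchyPow, setIntegral_eq_integral_of_forall_compl_eq_zero]
    intro t ht
    rw [hR t ht, zero_mul]
  rw [h1]
  have h2 : ∀ t ∈ Icc (-R) R, ‖f t * ((z - t)⁻¹) ^ n‖
      ≤ M * ((1 + (R + 1) / α) / (1 + ‖z‖)) ^ n := by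
    intro t ht
    rw [norm_mul, norm_pow]
    gcongr
    · exact hM t
    · have h3 : α ≤ ‖z - t‖ := by
        have := Complex.abs_im_le_norm (z - t)
        simp at this
        exact (hz.trans (le_abs_self _)).trans this
      have h4 : ‖z‖ ≤ ‖z - t‖ + R := by
        have h5 := norm_add_le (z - t) t
        rw [sub_add_cancel, Complex.norm_real, Real.norm_eq_abs] at h5
        have := abs_le.2 ht
        linarith
      rw [norm_inv, inv_eq_one_div, div_le_div_iff₀ (hα.trans_le h3) (by positivity)]
      have h6 : R + 1 ≤ (R + 1) / α * ‖z - t‖ := by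
        rw [div_mul_eq_mul_div, le_div_iff₀ hα]
        gcongr
      linarith
  refine (norm_setIntegral_le_of_norm_le_const (by simp) h2).trans (le_of_eq ?_)
  rw [Real.volume_real_Icc_of_le (by linarith), div_pow]
  ring

/-- The operator with kernel `1 / (α - i (x - t))`. -/
def cauchyOp (α : ℝ) (f : ℝ → ℂ) (x : ℝ) : ℂ := ∫ t, f t * ((α : ℂ) - (x - t) * Complex.I)⁻¹

lemma cauchyOp_eq_cauchyPow (α : ℝ) (f : ℝ → ℂ) (x : ℝ) :
    cauchyOp α f x = Complex.I * cauchyPow f 1 (x + α * Complex.I) := by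
  rw [cauchyOp, cauchyPow, ← integral_const_mul]
  congr 1 with t
  have h : (x + α * Complex.I : ℂ) - t = Complex.I * (α - (x - t) * Complex.I) := by
    linear_combination (x - t : ℂ) * Complex.I_mul_I
  rw [h, pow_one, mul_inv]
  linear_combination (-(f t * ((α : ℂ) - (x - t) * Complex.I)⁻¹)) * (mul_inv_cancel₀ Complex.I_ne_zero)

lemma continuous_cauchyOp {α : ℝ} (hα : 0 < α) {f : ℝ → ℂ} (hf : Integrable f) :
    Continuous (cauchyOp α f) := by
  rw [show cauchyOp α f = fun x : ℝ => Complex.I * cauchyPow f 1 (x + α * Complex.I) from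
    funext (cauchyOp_eq_cauchyPow α f)]
  refine continuous_const.mul (continuous_iff_continuousAt.2 fun x => ?_)
  exact (hasDerivAt_comp_horizontal
    (hasDerivAt_cauchyPow hf 1 (z := x + α * Complex.I) (by simpa using hα))).continuousAt

/-- Young's inequality for convolution with an integrable kernel, in terms of lower integrals. -/
lemma lintegral_conv_rpow_le {q : ℝ} (hq : 1 < q) {f k : ℝ → ℝ≥0∞} (hf : Measurable f)
    (hk : Measurable k) {A : ℝ≥0∞} (hA : ∫⁻ x, k x = A) :
    ∫⁻ x, (∫⁻ t, f t * k (x - t)) ^ q ≤ A ^ q * ∫⁻ t, f t ^ q := by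
  have hq0 : 0 < q := by linarith
  have hc := Real.HolderConjugate.conjExponent hq
  set q' := q.conjExponent
  have hq'0 : 0 < q' := hc.symm.pos
  have hshift (x : ℝ) : ∫⁻ t, k (x - t) = A := by
    rw [lintegral_sub_left_eq_self, hA]
  have key (x : ℝ) : (∫⁻ t, f t * k (x - t)) ^ q
      ≤ A ^ (q - 1) * ∫⁻ t, f t ^ q * k (x - t) := by
    have h1 := ENNReal.lintegral_mul_le_Lp_mul_Lq volume hc
      (f := fun t => f t * k (x - t) ^ (1 / q)) (g := fun t => k (x - t) ^ (1 / q'))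
      (by fun_prop) (by fun_prop)
    have e1 : ∀ t, ((fun t => f t * k (x - t) ^ (1 / q)) * fun t => k (x - t) ^ (1 / q')) t
        = f t * k (x - t) := by
      intro t
      simp only [Pi.mul_apply]
      rw [mul_assoc, ← ENNReal.rpow_add_of_nonneg _ _ (by positivity) (by positivity)]
      have : 1 / q + 1 / q' = 1 := by simpa using hc.inv_add_inv_eq_one
      rw [this, ENNReal.rpow_one]
    have e2 : ∀ t, (f t * k (x - t) ^ (1 / q)) ^ q = f t ^ q * k (x - t) := by
      intro t
      rw [ENNReal.mul_rpow_of_nonneg _ _ hq0.le, ← ENNReal.rpow_mul,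
        one_div_mul_cancel hq0.ne', ENNReal.rpow_one]
    have e3 : ∀ t, (k (x - t) ^ (1 / q')) ^ q' = k (x - t) := by
      intro t
      rw [← ENNReal.rpow_mul, one_div_mul_cancel hq'0.ne', ENNReal.rpow_one]
    simp only [e1, e2, e3, hshift] at h1
    refine (ENNReal.rpow_le_rpow h1 hq0.le).trans (le_of_eq ?_)
    rw [ENNReal.mul_rpow_of_nonneg _ _ hq0.le, ← ENNReal.rpow_mul, ← ENNReal.rpow_mul,
      one_div_mul_cancel hq0.ne', ENNReal.rpow_one, mul_comm]
    congr 2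
    have := hc.sub_one_mul_conj
    field_simp
    linarith
  calc _ ≤ ∫⁻ x, A ^ (q - 1) * ∫⁻ t, f t ^ q * k (x - t) := lintegral_mono key
    _ = A ^ (q - 1) * ∫⁻ x, ∫⁻ t, f t ^ q * k (x - t) :=
        lintegral_const_mul _ (Measurable.lintegral_prod_right (by fun_prop))
    _ = A ^ (q - 1) * ∫⁻ t, ∫⁻ x, f t ^ q * k (x - t) := by
        rw [lintegral_lintegral_swap (by fun_prop)]
    _ = A ^ (q - 1) * ∫⁻ t, f t ^ q * A := by
        congr 2 with t
        rw [lintegral_const_mul _ (by fun_prop), lintegral_sub_right_eq_self, hA]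
    _ = _ := by
        rw [lintegral_mul_const _ (by fun_prop), mul_comm (∫⁻ t, f t ^ q), ← mul_assoc]
        congr 1
        conv_lhs => rw [← ENNReal.rpow_one A]
        rw [← ENNReal.rpow_mul, one_mul, ← ENNReal.rpow_add_of_nonneg _ _ (by linarith) zero_le_one]
        congr 1; ring

lemma lintegral_poisson {α : ℝ} (hα : 0 < α) :
    ∫⁻ x : ℝ, ENNReal.ofReal (α / (α ^ 2 + x ^ 2)) = ENNReal.ofReal π := by
  have h := ProbabilityTheory.lintegral_cauchyPDF_eq_one 0 (γ := α.toNNReal)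
    (Real.toNNReal_pos.2 hα).ne'
  have e (x : ℝ) : ENNReal.ofReal (α / (α ^ 2 + x ^ 2)) = ENNReal.ofReal π *
      ProbabilityTheory.cauchyPDF 0 α.toNNReal x := by
    rw [ProbabilityTheory.cauchyPDF_def, ProbabilityTheory.cauchyPDFReal_def,
      ← ENNReal.ofReal_mul pi_pos.le]
    congr 1
    rw [sub_zero, Real.coe_toNNReal _ hα.le, add_comm]
    field_simp
  simp only [e]
  rw [lintegral_const_mul _ (by fun_prop), h, mul_one]

lemma inv_sub_mul_I_re (α s : ℝ) :
    (((α : ℂ) - s * Complex.I)⁻¹).re = α / (α ^ 2 + s ^ 2) := by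
  rw [Complex.inv_re, Complex.normSq_apply]
  simp
  ring_nf

lemma norm_inv_sub_mul_I_le {α : ℝ} (hα : 0 < α) (s : ℝ) :
    ‖((α : ℂ) - s * Complex.I)⁻¹‖ ≤ α⁻¹ := by
  rw [norm_inv]
  refine inv_anti₀ hα ?_
  have := Complex.abs_re_le_norm ((α : ℂ) - s * Complex.I)
  simp at this
  exact (le_abs_self _).trans this

lemma integrable_mul_cauchyKernel {α : ℝ} (hα : 0 < α) {f : ℝ → ℂ} (hf : Integrable f) (x : ℝ) :
    Integrable fun t : ℝ => f t * ((α : ℂ) - (x - t) * Complex.I)⁻¹ := by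
  refine hf.mul_bdd (c := α⁻¹) (by fun_prop) (ae_of_all _ fun t => ?_)
  simpa using norm_inv_sub_mul_I_le hα (x - t)

lemma lintegral_re_cauchyOp_rpow_le {q α : ℝ} (hq : 1 < q) (hα : 0 < α) {f : ℝ → ℝ}
    (hf : Integrable f) (hfm : Measurable f) :
    ∫⁻ x, ‖(cauchyOp α (fun t => (f t : ℂ)) x).re‖ₑ ^ q ≤
      ENNReal.ofReal π ^ q * ∫⁻ t, ‖f t‖ₑ ^ q := by
  refine le_trans (lintegral_mono fun x => ?_) (lintegral_conv_rpow_le hq (f := fun t => ‖f t‖ₑ)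
    (by fun_prop) (by fun_prop) (lintegral_poisson hα))
  refine ENNReal.rpow_le_rpow ?_ (by linarith)
  have h1 : (cauchyOp α (fun t => (f t : ℂ)) x).re
      = ∫ t, f t * (α / (α ^ 2 + (x - t) ^ 2)) := by
    have := integral_re (integrable_mul_cauchyKernel hα hf.ofReal x)
    simp only [RCLike.re_to_complex] at this
    rw [cauchyOp]
    refine this.symm.trans ?_
    congr 1 with t
    have := inv_sub_mul_I_re α (x - t)
    push_cast at this
    simp [this]
  rw [h1]
  refine (enorm_integral_le_lintegral_enorm _).trans (lintegral_mono fun t => ?_)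
  rw [enorm_mul, Real.enorm_of_nonneg (r := α / (α ^ 2 + (x - t) ^ 2)) (by positivity)]

/-- Bounded measurable functions vanishing outside a bounded interval. -/
structure BddSupp (f : ℝ → ℂ) : Prop where
  measurable : Measurable f
  exists_bound : ∃ M, ∀ t, ‖f t‖ ≤ M
  exists_support : ∃ R : ℝ, 0 ≤ R ∧ ∀ t, t ∉ Icc (-R) R → f t = 0

lemma BddSupp.integrable {f : ℝ → ℂ} (hf : BddSupp f) : Integrable f := by
  obtain ⟨M, hM⟩ := hf.exists_bound
  obtain ⟨R, -, hR⟩ := hf.exists_support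
  have h : IntegrableOn f (Icc (-R) R) :=
    Measure.integrableOn_of_bounded (M := M) (by simp) hf.measurable.aestronglyMeasurable
      (ae_of_all _ hM)
  rwa [integrableOn_iff_integrable_of_support_subset] at h
  intro t ht
  by_contra hn
  exact ht (hR t hn)

lemma rpow_add_sub_le {δ r s : ℝ} (hδ : 0 ≤ δ) (hr : 0 ≤ r) (hr' : r ≤ 1) (hs : 0 ≤ s) :
    (δ + s) ^ r - δ ^ r ≤ s ^ r := by
  have := Real.rpow_add_le_add_rpow hδ hs hr hr'
  linarith

lemma tendsto_rpow_add_sub {r s : ℝ} (hr : 0 < r) :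
    Tendsto (fun n : ℕ => ((1 / ((n : ℝ) + 1) + s) ^ r - (1 / ((n : ℝ) + 1)) ^ r)) atTop
      (𝓝 (s ^ r)) := by
  have h0 := tendsto_one_div_add_atTop_nhds_zero_nat (𝕜 := ℝ)
  have h1 := ((h0.add_const s).rpow_const (p := r) (Or.inr hr.le)).sub
    (h0.rpow_const (p := r) (Or.inr hr.le))
  simpa [Real.zero_rpow hr.ne'] using h1

open RieszFunctional in
/-- The `L^q` norm of a Cauchy integral of a real function is controlled by that of its real
part, `1 < q ≤ 2`. -/
lemma lintegral_cauchyOp_rpow_le_re {q α : ℝ} (hq : 1 < q) (hq2 : q ≤ 2) (hα : 0 < α)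
    {f : ℝ → ℂ} (hf : BddSupp f) :
    ∫⁻ x, ‖cauchyOp α f x‖ₑ ^ q ≤
      ENNReal.ofReal (2 / (q - 1)) * ∫⁻ x, ‖(cauchyOp α f x).re‖ₑ ^ q := by
  obtain ⟨M, hM⟩ := hf.exists_bound
  obtain ⟨R, hR0, hR⟩ := hf.exists_support
  have hM0 : 0 ≤ M := (norm_nonneg _).trans (hM 0)
  set r := q / 2 with hr_def
  have hr : 1 / 2 < r := by rw [hr_def]; linarith
  have hr0 : 0 < r := by linarith
  have hr' : r ≤ 1 := by rw [hr_def]; linarith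
  have h2r : 2 * r - 1 = q - 1 := by rw [hr_def]; ring
  set c := 2 / (2 * r - 1) with hc
  have hc0 : 0 ≤ c := (div_pos two_pos (by linarith)).le
  set L := 1 + (R + 1) / α with hL
  have hL1 : 1 ≤ L := by rw [hL]; have : 0 ≤ (R + 1) / α := by positivity
                         linarith
  set C := 2 * (M * L ^ 3 * (2 * R)) with hC
  have hb (n : ℕ) (hn : n ≤ 3) (z : ℂ) (hz : α ≤ z.im) :
      2 * ‖cauchyPow f n z‖ ≤ C / (1 + ‖z‖) ^ n := by
    refine (mul_le_mul_of_nonneg_left (norm_cauchyPow_le hM hR hR0 hα n hz) two_pos.le).trans ?_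
    rw [← mul_div_assoc, hC]
    gcongr
  have hcont : Continuous (cauchyOp α f) := continuous_cauchyOp hα hf.integrable
  have hdecay (x : ℝ) : ‖cauchyOp α f x‖ ^ 2 ≤ C ^ 2 * (1 + |x|) ^ (-2 : ℝ) := by
    have h1 := hb 1 (by norm_num) (x + α * Complex.I) (by simp)
    rw [pow_one] at h1
    have h2 : ‖cauchyOp α f x‖ ≤ C / (1 + |x|) := by
      rw [cauchyOp_eq_cauchyPow, norm_mul, Complex.norm_I, one_mul]
      have h3 : C / (1 + ‖(x + α * Complex.I : ℂ)‖) ≤ C / (1 + |x|) :=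
        div_le_div_of_nonneg_left (by positivity) (by positivity) (one_add_abs_le_left x α)
      have := norm_nonneg (cauchyPow f 1 (x + α * Complex.I))
      linarith
    rw [Real.rpow_neg (by positivity), show (2 : ℝ) = ((2 : ℕ) : ℝ) by norm_num,
      Real.rpow_natCast, ← div_eq_mul_inv, ← div_pow]
    gcongr
  have hsq (w : ℂ) : ‖w‖ ^ 2 = w.re ^ 2 + w.im ^ 2 := by
    rw [← Complex.normSq_eq_norm_sq, Complex.normSq_apply]; ring
  have hintegr (δ : ℝ) (hδ : 0 < δ) (g : ℝ → ℝ) (hg : Continuous g) (hg0 : ∀ x, 0 ≤ g x)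
      (hgle : ∀ x, g x ≤ ‖cauchyOp α f x‖ ^ 2) :
      Integrable (fun x => (δ + g x) ^ r - δ ^ r) := by
    refine ((integrable_one_add_abs_rpow (s := 2) (by norm_num)).const_mul
      (δ ^ (r - 1) * C ^ 2)).mono' ?_ (ae_of_all _ fun x => ?_)
    · refine Continuous.aestronglyMeasurable ?_
      exact ((continuous_const.add hg).rpow_const fun x => Or.inr hr0.le).sub continuous_const
    · refine (abs_rpow_add_sub_le hδ hr0 hr' (hg0 x)).trans ?_
      rw [mul_assoc]
      exact mul_le_mul_of_nonneg_left ((hgle x).trans (hdecay x)) (by positivity)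
  have hmain (δ : ℝ) (hδ : 0 < δ) :
      ∫ x, ((δ + ‖cauchyOp α f x‖ ^ 2) ^ r - δ ^ r) ≤
        c * ∫ x, ((δ + (cauchyOp α f x).re ^ 2) ^ r - δ ^ r) := by
    have h := integral_val_nonpos (F := fun z => Complex.I * cauchyPow f 1 z)
      (F₁ := fun z => Complex.I * (-(1 : ℕ) * cauchyPow f 2 z))
      (F₂ := fun z => Complex.I * (-(1 : ℕ) * (-(2 : ℕ) * cauchyPow f 3 z)))
      (C := C) (r := r) hα hδ hr hr'
      (fun z hz => (hasDerivAt_cauchyPow hf.integrable 1 hz).const_mul _)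
      (fun z hz => ((hasDerivAt_cauchyPow hf.integrable 2 hz).const_mul _).const_mul _)
      (fun z hz => ((((hasDerivAt_cauchyPow hf.integrable 3 hz).const_mul _).const_mul
        _).const_mul _).continuousAt.continuousWithinAt)
      (fun z hz => ?_) (fun z hz => ?_) (fun z hz => ?_)
    · simp only [← cauchyOp_eq_cauchyPow, val] at h
      rw [integral_sub, integral_const_mul] at h
      · simp only [hsq]
        linarith
      · simp only [← hsq]
        exact hintegr δ hδ _ (by fun_prop) (fun x => by positivity) (fun x => le_rfl)
      · refine (hintegr δ hδ _ (by fun_prop) (fun x => by positivity) (fun x => ?_)).const_mul _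
        rw [hsq]
        nlinarith [sq_nonneg (cauchyOp α f x).im]
    · have := hb 1 (by norm_num) z hz
      have h0 := norm_nonneg (cauchyPow f 1 z)
      simp only [norm_mul, Complex.norm_I, one_mul]
      rw [pow_one] at this
      linarith
    · have := hb 2 (by norm_num) z hz
      have h0 := norm_nonneg (cauchyPow f 2 z)
      simp only [norm_mul, Complex.norm_I, one_mul, norm_neg, Nat.cast_one, norm_one]
      linarith
    · have := hb 3 (by norm_num) z hz
      simpa [norm_mul] using this
  have hpow (y : ℝ) : ‖y‖ₑ ^ q = ENNReal.ofReal ((y ^ 2) ^ r) := by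
    rw [← sq_abs, ← Real.rpow_natCast, ← Real.rpow_mul (abs_nonneg y),
      show ((2 : ℕ) : ℝ) * r = q by rw [hr_def]; push_cast; ring,
      ← ENNReal.ofReal_rpow_of_nonneg (abs_nonneg y) (by linarith), ← Real.norm_eq_abs,
      ofReal_norm]
  have hstep (δ : ℝ) (hδ : 0 < δ) :
      ∫⁻ x, ENNReal.ofReal ((δ + ‖cauchyOp α f x‖ ^ 2) ^ r - δ ^ r) ≤
        ENNReal.ofReal c * ∫⁻ x, ‖(cauchyOp α f x).re‖ₑ ^ q := by
    have hnn (s : ℝ) (hs : 0 ≤ s) : 0 ≤ (δ + s) ^ r - δ ^ r :=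
      sub_nonneg.2 (Real.rpow_le_rpow hδ.le (by linarith) hr0.le)
    rw [← ofReal_integral_eq_lintegral_ofReal
      (hintegr δ hδ _ (by fun_prop) (fun x => by positivity) (fun x => le_rfl))
      (ae_of_all _ fun x => hnn _ (by positivity))]
    refine (ENNReal.ofReal_le_ofReal (hmain δ hδ)).trans ?_
    rw [ENNReal.ofReal_mul hc0, ofReal_integral_eq_lintegral_ofReal
      (hintegr δ hδ _ (by fun_prop) (fun x => by positivity) (fun x => by
        rw [hsq]; nlinarith [sq_nonneg (cauchyOp α f x).im]))
      (ae_of_all _ fun x => hnn _ (by positivity))]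
    gcongr with x
    rw [hpow]
    exact ENNReal.ofReal_le_ofReal (rpow_add_sub_le hδ.le hr0.le hr' (by positivity))
  rw [← h2r]
  calc ∫⁻ x, ‖cauchyOp α f x‖ₑ ^ q
      = ∫⁻ x, liminf (fun n : ℕ => ENNReal.ofReal ((1 / ((n : ℝ) + 1)
          + ‖cauchyOp α f x‖ ^ 2) ^ r - (1 / ((n : ℝ) + 1)) ^ r)) atTop := by
        refine lintegral_congr fun x => ?_
        rw [← enorm_norm, hpow]
        exact ((ENNReal.tendsto_ofReal (tendsto_rpow_add_sub hr0)).liminf_eq).symm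
    _ ≤ liminf (fun n : ℕ => ∫⁻ x, ENNReal.ofReal ((1 / ((n : ℝ) + 1)
          + ‖cauchyOp α f x‖ ^ 2) ^ r - (1 / ((n : ℝ) + 1)) ^ r)) atTop := by
        refine lintegral_liminf_le fun n => ?_
        have := hcont.measurable
        fun_prop
    _ ≤ _ := by
        refine liminf_le_of_le (by isBoundedDefault) fun b hb => ?_
        obtain ⟨n, hn⟩ := hb.exists
        exact hn.trans (hstep _ (by positivity))

/-! ### Uniform `L^q` bounds for the Cauchy integral on the line -/

lemma BddSupp.of_norm_le {f g : ℝ → ℂ} (hf : BddSupp f) (hg : Measurable g)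
    (h : ∀ t, ‖g t‖ ≤ ‖f t‖) : BddSupp g := by
  obtain ⟨M, hM⟩ := hf.exists_bound
  obtain ⟨R, hR0, hR⟩ := hf.exists_support
  refine ⟨hg, ⟨M, fun t => (h t).trans (hM t)⟩, ⟨R, hR0, fun t ht => ?_⟩⟩
  have := h t
  rw [hR t ht, norm_zero] at this
  exact norm_le_zero_iff.1 this

lemma lintegral_cauchyOp_ofReal_rpow_le {q α : ℝ} (hq : 1 < q) (hq2 : q ≤ 2) (hα : 0 < α)
    {f : ℝ → ℝ} (hf : BddSupp fun t => (f t : ℂ)) :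
    ∫⁻ x, ‖cauchyOp α (fun t => (f t : ℂ)) x‖ₑ ^ q ≤
      (ENNReal.ofReal (2 / (q - 1)) * ENNReal.ofReal π ^ q) * ∫⁻ t, ‖f t‖ₑ ^ q := by
  rw [mul_assoc]
  refine (lintegral_cauchyOp_rpow_le_re hq hq2 hα hf).trans ?_
  gcongr
  refine lintegral_re_cauchyOp_rpow_le hq hα ?_ ?_
  · simpa using hf.integrable.re
  · simpa [Function.comp_def] using Complex.measurable_re.comp hf.measurable

lemma exists_lintegral_cauchyOp_rpow_le_of_le_two {q : ℝ} (hq : 1 < q) (hq2 : q ≤ 2) :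
    ∃ K : ℝ≥0, ∀ α : ℝ, 0 < α → ∀ f : ℝ → ℂ, BddSupp f →
      ∫⁻ x, ‖cauchyOp α f x‖ₑ ^ q ≤ K * ∫⁻ t, ‖f t‖ₑ ^ q := by
  have hq0 : 0 ≤ q := by linarith
  set B : ℝ≥0∞ := ENNReal.ofReal (2 / (q - 1)) * ENNReal.ofReal π ^ q with hB
  have hBtop : B ≠ ∞ := ENNReal.mul_ne_top ENNReal.ofReal_ne_top
    (ENNReal.rpow_ne_top_of_nonneg hq0 ENNReal.ofReal_ne_top)
  set D : ℝ≥0∞ := (2 : ℝ≥0∞) ^ (q - 1) * (B + B) with hD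
  have hDtop : D ≠ ∞ := ENNReal.mul_ne_top
    (ENNReal.rpow_ne_top_of_nonneg (by linarith) (by norm_num)) (by simp [hBtop])
  refine ⟨D.toNNReal, fun α hα f hf => ?_⟩
  rw [ENNReal.coe_toNNReal hDtop]
  have hre : BddSupp fun t => ((f t).re : ℂ) :=
    hf.of_norm_le (by have := hf.measurable; fun_prop) fun t => by
      simpa using Complex.abs_re_le_norm (f t)
  have him : BddSupp fun t => ((f t).im : ℂ) :=
    hf.of_norm_le (by have := hf.measurable; fun_prop) fun t => by
      simpa using Complex.abs_im_le_norm (f t)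
  have hsplit (x : ℝ) : cauchyOp α f x = cauchyOp α (fun t => ((f t).re : ℂ)) x
      + Complex.I * cauchyOp α (fun t => ((f t).im : ℂ)) x := by
    simp only [cauchyOp]
    rw [← integral_const_mul, ← integral_add]
    · refine integral_congr_ae (ae_of_all _ fun t => ?_)
      have := Complex.re_add_im (f t)
      simp only
      rw [← mul_assoc, ← add_mul, mul_comm Complex.I, this]
    · exact integrable_mul_cauchyKernel hα hre.integrable x
    · exact (integrable_mul_cauchyKernel hα him.integrable x).const_mul _
  have hle (g : ℝ → ℝ) (hg : ∀ t, ‖g t‖ ≤ ‖f t‖) :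
      ∫⁻ t, ‖g t‖ₑ ^ q ≤ ∫⁻ t, ‖f t‖ₑ ^ q := by
    refine lintegral_mono fun t => ?_
    exact ENNReal.rpow_le_rpow (enorm_le_iff_norm_le.2 (hg t)) hq0
  calc ∫⁻ x, ‖cauchyOp α f x‖ₑ ^ q
      ≤ ∫⁻ x, (2 : ℝ≥0∞) ^ (q - 1) * (‖cauchyOp α (fun t => ((f t).re : ℂ)) x‖ₑ ^ q
          + ‖cauchyOp α (fun t => ((f t).im : ℂ)) x‖ₑ ^ q) := by
        refine lintegral_mono fun x => ?_
        rw [hsplit]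
        refine (ENNReal.rpow_le_rpow (enorm_add_le _ _) hq0).trans ?_
        rw [enorm_mul, show ‖Complex.I‖ₑ = 1 by simp [enorm], one_mul]
        exact ENNReal.rpow_add_le_mul_rpow_add_rpow _ _ hq.le
    _ = (2 : ℝ≥0∞) ^ (q - 1) * ((∫⁻ x, ‖cauchyOp α (fun t => ((f t).re : ℂ)) x‖ₑ ^ q)
          + ∫⁻ x, ‖cauchyOp α (fun t => ((f t).im : ℂ)) x‖ₑ ^ q) := by
        have h1 := (continuous_cauchyOp hα hre.integrable).measurable
        have h2 := (continuous_cauchyOp hα him.integrable).measurable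
        rw [lintegral_const_mul _ (by fun_prop), lintegral_add_left (by fun_prop)]
    _ ≤ (2 : ℝ≥0∞) ^ (q - 1) * ((B * ∫⁻ t, ‖f t‖ₑ ^ q) + B * ∫⁻ t, ‖f t‖ₑ ^ q) := by
        gcongr
        · exact (lintegral_cauchyOp_ofReal_rpow_le hq hq2 hα hre).trans (mul_le_mul_right
            (hle _ fun t => Complex.abs_re_le_norm (f t)) B)
        · exact (lintegral_cauchyOp_ofReal_rpow_le hq hq2 hα him).trans (mul_le_mul_right
            (hle _ fun t => Complex.abs_im_le_norm (f t)) B)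
    _ = D * ∫⁻ t, ‖f t‖ₑ ^ q := by rw [hD]; ring

lemma integral_cauchyOp_mul {α : ℝ} (hα : 0 < α) {f g : ℝ → ℂ} (hf : BddSupp f)
    (hg : BddSupp g) :
    ∫ x, cauchyOp α f x * g x =
      ∫ t, f t * (starRingEnd ℂ) (cauchyOp α (fun x => (starRingEnd ℂ) (g x)) t) := by
  have h1 : ∀ x, cauchyOp α f x * g x
      = ∫ t : ℝ, f t * ((α : ℂ) - (x - t) * Complex.I)⁻¹ * g x := fun x => by
    rw [cauchyOp, integral_mul_const]
  have h2 : ∀ t, f t * (starRingEnd ℂ) (cauchyOp α (fun x => (starRingEnd ℂ) (g x)) t)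
      = ∫ x : ℝ, f t * ((α : ℂ) - (x - t) * Complex.I)⁻¹ * g x := fun t => by
    rw [cauchyOp, ← integral_conj, ← integral_const_mul]
    refine integral_congr_ae (ae_of_all _ fun x => ?_)
    simp only [map_mul, map_inv₀, map_sub, Complex.conj_conj, Complex.conj_ofReal, Complex.conj_I]
    rw [mul_comm (g x), mul_assoc]
    congr 3
    ring
  simp only [h1, h2]
  refine integral_integral_swap ?_
  have hVint : Integrable (fun z : ℝ × ℝ => g z.1 * f z.2) (volume.prod volume) :=
    hg.integrable.mul_prod hf.integrable
  refine (hVint.norm.mul_const α⁻¹).mono' ?_ (ae_of_all _ fun z => ?_)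
  · have hfm := hf.measurable
    have hgm := hg.measurable
    refine Measurable.aestronglyMeasurable ?_
    simp only [Function.uncurry_def]
    fun_prop
  · have := norm_inv_sub_mul_I_le hα (z.1 - z.2)
    push_cast at this
    simp only [Function.uncurry_def, norm_mul] at this ⊢
    calc _ = ‖g z.1‖ * ‖f z.2‖ * ‖((α : ℂ) - (z.1 - z.2) * Complex.I)⁻¹‖ := by ring
      _ ≤ _ := by gcongr

lemma exists_lintegral_cauchyOp_rpow_le {q : ℝ} (hq : 1 < q) :
    ∃ K : ℝ≥0, ∀ α : ℝ, 0 < α → ∀ f : ℝ → ℂ, BddSupp f →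
      ∫⁻ x, ‖cauchyOp α f x‖ₑ ^ q ≤ K * ∫⁻ t, ‖f t‖ₑ ^ q := by
  rcases le_or_gt q 2 with hq2 | hq2
  · exact exists_lintegral_cauchyOp_rpow_le_of_le_two hq hq2
  have hq0 : 0 < q := by linarith
  have hqq : q.HolderConjugate (q / (q - 1)) := Real.HolderConjugate.conjExponent hq
  set q' := q / (q - 1) with hq'
  obtain ⟨K, hK⟩ := exists_lintegral_cauchyOp_rpow_le_of_le_two (q := q') hqq.symm.lt (by
    rw [hq', div_le_iff₀ (by linarith)]; linarith)
  have hq'0 : 0 < q' := hqq.symm.pos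
  have hmul : (q - 1) * q' = q := by
    rw [hq']; field_simp [show q - 1 ≠ 0 by linarith]
  refine ⟨K ^ (q - 1), fun α hα f hf => ?_⟩
  set w := cauchyOp α f with hw
  have hwc : Continuous w := continuous_cauchyOp hα hf.integrable
  set F := ∫⁻ t, ‖f t‖ₑ ^ q with hF
  have hbound (n : ℕ) : ∫⁻ x in Icc (-(n : ℝ)) n, ‖w x‖ₑ ^ q ≤ (K : ℝ≥0∞) ^ (q - 1) * F := by
    set S := Icc (-(n : ℝ)) n with hS
    have hSm : MeasurableSet S := measurableSet_Icc
    set g : ℝ → ℂ := S.indicator fun x => (starRingEnd ℂ) (w x) * ((‖w x‖ ^ (q - 2) : ℝ) : ℂ)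
      with hg
    have hcg : Continuous fun x => (starRingEnd ℂ) (w x) * ((‖w x‖ ^ (q - 2) : ℝ) : ℂ) := by
      refine (Complex.continuous_conj.comp hwc).mul (Complex.continuous_ofReal.comp ?_)
      exact hwc.norm.rpow_const fun x => Or.inr (by linarith)
    have hgB : BddSupp g := by
      obtain ⟨M, hM⟩ := (isCompact_Icc (a := -(n : ℝ)) (b := n)).exists_bound_of_continuousOn
        hcg.continuousOn
      refine ⟨hcg.measurable.indicator hSm, ⟨max M 0, fun t => ?_⟩, ⟨n, by positivity,
        fun t ht => indicator_of_notMem ht _⟩⟩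
      by_cases ht : t ∈ S
      · rw [hg, indicator_of_mem ht]; exact (hM t ht).trans (le_max_left _ _)
      · rw [hg, indicator_of_notMem ht, norm_zero]; exact le_max_right _ _
    have hgB' : BddSupp fun x => (starRingEnd ℂ) (g x) :=
      hgB.of_norm_le (by have := hgB.measurable; fun_prop) fun t => by simp
    have hnorm (x : ℝ) : ‖w x‖ ^ (q - 2) * ‖w x‖ = ‖w x‖ ^ (q - 1) := by
      rcases eq_or_ne ‖w x‖ 0 with h | h
      · rw [h, mul_zero, Real.zero_rpow (by linarith)]
      · rw [← Real.rpow_add_one h]; congr 1; ring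
    have hgn (x : ℝ) : ‖g x‖ₑ ^ q' = S.indicator (fun x => ‖w x‖ₑ ^ q) x := by
      by_cases hx : x ∈ S
      · rw [hg, indicator_of_mem hx, indicator_of_mem hx, ← ofReal_norm, norm_mul,
          Complex.norm_conj, Complex.norm_real, Real.norm_of_nonneg (by positivity),
          mul_comm, hnorm, ← ENNReal.ofReal_rpow_of_nonneg (norm_nonneg _) (by linarith),
          ofReal_norm, ← ENNReal.rpow_mul, hmul]
      · rw [hg, indicator_of_notMem hx, indicator_of_notMem hx, enorm_zero,
          ENNReal.zero_rpow_of_pos hq'0]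
    have hwg (x : ℝ) : w x * g x = ((S.indicator (fun x => ‖w x‖ ^ q) x : ℝ) : ℂ) := by
      by_cases hx : x ∈ S
      · rw [hg, indicator_of_mem hx, indicator_of_mem hx, ← mul_assoc, Complex.mul_conj,
          Complex.normSq_eq_norm_sq, ← Complex.ofReal_mul, sq, mul_assoc, mul_comm ‖w x‖ (_ ^ _),
          hnorm, mul_comm]
        congr 1
        rcases eq_or_ne ‖w x‖ 0 with h | h
        · rw [h, Real.zero_rpow hq0.ne', mul_zero]
        · rw [← Real.rpow_add_one h]; congr 1; ring
      · rw [hg, indicator_of_notMem hx, indicator_of_notMem hx, mul_zero, Complex.ofReal_zero]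
    set J := ∫⁻ x in S, ‖w x‖ₑ ^ q with hJ
    have hcq : Continuous fun x => ‖w x‖ ^ q := hwc.norm.rpow_const fun x => Or.inr hq0.le
    have hIS : IntegrableOn (fun x => ‖w x‖ ^ q) S := hcq.continuousOn.integrableOn_compact
      isCompact_Icc
    have hJeq : J = ENNReal.ofReal (∫ x in S, ‖w x‖ ^ q) := by
      rw [ofReal_integral_eq_lintegral_ofReal hIS (ae_of_all _ fun x => by positivity), hJ]
      refine lintegral_congr fun x => ?_
      rw [← ENNReal.ofReal_rpow_of_nonneg (norm_nonneg _) hq0.le, ofReal_norm]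
    have hJtop : J ≠ ∞ := by rw [hJeq]; exact ENNReal.ofReal_ne_top
    have hJint : J = ‖∫ x, w x * g x‖ₑ := by
      simp only [hwg]
      rw [integral_complex_ofReal, integral_indicator hSm, ← ofReal_norm, Complex.norm_real,
        Real.norm_of_nonneg (integral_nonneg fun x => by positivity), hJeq]
    have hgJ : ∫⁻ x, ‖g x‖ₑ ^ q' = J := by
      simp only [hgn]; rw [lintegral_indicator hSm]
    have hdual : J ≤ F ^ (1 / q) * (K * J) ^ (1 / q') := by
      refine (hJint.trans (congrArg _ (integral_cauchyOp_mul hα hf hgB))).trans_le ?_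
      refine (enorm_integral_le_lintegral_enorm _).trans ?_
      simp only [enorm_mul]
      have hm1 := hf.measurable
      have hm2 := (continuous_cauchyOp hα hgB'.integrable).measurable
      refine (ENNReal.lintegral_mul_le_Lp_mul_Lq volume hqq (f := fun t => ‖f t‖ₑ)
        (by fun_prop) (by fun_prop)).trans ?_
      gcongr
      have := hK α hα _ hgB'
      simpa only [RCLike.enorm_conj, hgJ] using this
    have hpow : J ^ q ≤ F * (K * J) ^ (q - 1) := by
      refine (ENNReal.rpow_le_rpow hdual hq0.le).trans ?_
      rw [ENNReal.mul_rpow_of_nonneg _ _ hq0.le, ← ENNReal.rpow_mul, ← ENNReal.rpow_mul,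
        one_div_mul_cancel hq0.ne', ENNReal.rpow_one, show 1 / q' * q = q - 1 by
          rw [hq']; field_simp]
    rcases eq_or_ne J 0 with h0 | h0
    · rw [h0]; exact zero_le
    rw [ENNReal.mul_rpow_of_nonneg _ _ (by linarith), ← mul_assoc,
      show J ^ q = J * J ^ (q - 1) by
        conv_lhs => rw [show q = 1 + (q - 1) by ring]
        rw [ENNReal.rpow_add _ _ h0 hJtop, ENNReal.rpow_one]] at hpow
    rw [mul_comm _ F]
    refine (ENNReal.mul_le_mul_iff_left ?_ ?_).1 hpow
    · simp [h0, hJtop, ENNReal.rpow_eq_zero_iff]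
    · exact ENNReal.rpow_ne_top_of_nonneg (by linarith) hJtop
  have hU : ⋃ n : ℕ, Icc (-(n : ℝ)) n = univ := by
    refine eq_univ_of_forall fun x => ?_
    obtain ⟨n, hn⟩ := exists_nat_ge |x|
    exact mem_iUnion.2 ⟨n, abs_le.1 hn⟩
  have hdir : Directed (· ⊆ ·) fun n : ℕ => Icc (-(n : ℝ)) n :=
    (monotone_nat_of_le_succ fun n => Icc_subset_Icc (by simp) (by simp)).directed_le
  rw [← setLIntegral_univ, ← hU, setLIntegral_iUnion_of_directed _ hdir,
    ENNReal.coe_rpow_of_nonneg _ (by linarith)]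
  exact iSup_le hbound

/-! ### Integrable truncations of the Cauchy kernel -/

/-- The symbol `1_{ξ > 0} (e^{-2παξ} - e^{-2πβξ})`. -/
def halfLineSymbol (α β ξ : ℝ) : ℂ :=
  Complex.exp (-(2 * π * α * max ξ 0 : ℝ)) - Complex.exp (-(2 * π * β * max ξ 0 : ℝ))

/-- The inverse Fourier transform of `halfLineSymbol α β`. -/
def cauchyKernel (α β t : ℝ) : ℂ :=
  ((2 * π : ℝ) : ℂ)⁻¹ * (((α : ℂ) - t * Complex.I)⁻¹ - ((β : ℂ) - t * Complex.I)⁻¹)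

lemma continuous_halfLineSymbol (α β : ℝ) : Continuous (halfLineSymbol α β) := by
  unfold halfLineSymbol
  fun_prop

lemma halfLineSymbol_of_nonpos (α β : ℝ) {ξ : ℝ} (hξ : ξ ≤ 0) : halfLineSymbol α β ξ = 0 := by
  simp [halfLineSymbol, max_eq_right hξ]

lemma halfLineSymbol_eq_indicator (α β : ℝ) : halfLineSymbol α β = (Ioi 0).indicator
    fun ξ : ℝ => Complex.exp ((-(2 * π * α) : ℝ) * ξ) - Complex.exp ((-(2 * π * β) : ℝ) * ξ) := by
  funext ξ
  by_cases hξ : 0 < ξ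
  · rw [indicator_of_mem (mem_Ioi.2 hξ), halfLineSymbol, max_eq_left hξ.le]
    push_cast
    simp only [neg_mul]
  · rw [indicator_of_notMem (by simpa using hξ), halfLineSymbol_of_nonpos _ _ (not_lt.1 hξ)]

lemma norm_halfLineSymbol_le {α β : ℝ} (hα : 0 < α) (hβ : 0 < β) (ξ : ℝ) :
    ‖halfLineSymbol α β ξ‖ ≤ 2 := by
  have h (γ : ℝ) (hγ : 0 < γ) : ‖Complex.exp (-(2 * π * γ * max ξ 0 : ℝ))‖ ≤ 1 := by
    rw [Complex.norm_exp]
    refine Real.exp_le_one_iff.2 ?_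
    have : 0 ≤ 2 * π * γ * max ξ 0 := by positivity
    simpa using this
  refine (norm_sub_le _ _).trans ?_
  linarith [h α hα, h β hβ]

lemma integrable_halfLineSymbol {α β : ℝ} (hα : 0 < α) (hβ : 0 < β) :
    Integrable (halfLineSymbol α β) := by
  rw [halfLineSymbol_eq_indicator, integrable_indicator_iff measurableSet_Ioi]
  refine (integrableOn_exp_mul_complex_Ioi ?_ 0).sub (integrableOn_exp_mul_complex_Ioi ?_ 0)
  · simpa using by positivity
  · simpa using by positivity

lemma fourierInv_halfLineSymbol {α β : ℝ} (hα : 0 < α) (hβ : 0 < β) :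
    𝓕⁻ (halfLineSymbol α β) = cauchyKernel α β := by
  funext x
  rw [Real.fourierInv_eq', halfLineSymbol_eq_indicator]
  have hexp (γ : ℝ) (hγ : 0 < γ) :
      (((-(2 * π * γ) : ℝ) : ℂ) + (2 * π * x : ℝ) * Complex.I).re < 0 := by
    simpa using by positivity
  have key (γ : ℝ) (hγ : 0 < γ) :
      ∫ ξ : ℝ in Ioi 0, Complex.exp ((((-(2 * π * γ) : ℝ) : ℂ) + (2 * π * x : ℝ) * Complex.I) * ξ)
        = ((2 * π : ℝ) : ℂ)⁻¹ * ((γ : ℂ) - x * Complex.I)⁻¹ := by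
    rw [integral_exp_mul_complex_Ioi (hexp γ hγ)]
    rw [← mul_inv, show (((2 * π : ℝ) : ℂ) * ((γ : ℂ) - x * Complex.I))
      = -(((-(2 * π * γ) : ℝ) : ℂ) + (2 * π * x : ℝ) * Complex.I) by push_cast; ring]
    rw [inv_neg, Complex.ofReal_zero, mul_zero, Complex.exp_zero, neg_div, one_div]
  rw [cauchyKernel, mul_sub, ← key α hα, ← key β hβ, ← integral_sub
    (integrableOn_exp_mul_complex_Ioi (hexp α hα) 0)
    (integrableOn_exp_mul_complex_Ioi (hexp β hβ) 0), ← integral_indicator measurableSet_Ioi]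
  refine integral_congr_ae (ae_of_all _ fun ξ => ?_)
  by_cases hξ : ξ ∈ Ioi (0 : ℝ)
  · simp only [indicator_of_mem hξ, smul_eq_mul, mul_sub, ← Complex.exp_add]
    congr 2 <;> simp <;> ring
  · simp [indicator_of_notMem hξ]

lemma integrable_cauchyKernel {α β : ℝ} (hα : 0 < α) (hβ : 0 < β) :
    Integrable (cauchyKernel α β) := by
  have hne (γ : ℝ) (hγ : 0 < γ) (t : ℝ) : (γ : ℂ) - t * Complex.I ≠ 0 := fun h => by
    have := congrArg Complex.re h
    simp at this
    linarith
  have hcont : Continuous (cauchyKernel α β) := by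
    unfold cauchyKernel
    refine continuous_const.mul (Continuous.sub ?_ ?_)
    · exact Continuous.inv₀ (by fun_prop) (hne α hα)
    · exact Continuous.inv₀ (by fun_prop) (hne β hβ)
  have hVint (γ : ℝ) (hγ : 0 < γ) : Integrable fun t : ℝ => (γ ^ 2 + t ^ 2)⁻¹ := by
    refine ((integrable_inv_one_add_sq.comp_div hγ.ne').const_mul (γ ^ 2)⁻¹).congr
      (ae_of_all _ fun t => ?_)
    simp only
    rw [← mul_inv]
    congr 1
    field_simp
  have hsq (γ : ℝ) (t : ℝ) : ‖(γ : ℂ) - t * Complex.I‖ ^ 2 = γ ^ 2 + t ^ 2 := by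
    rw [← Complex.normSq_eq_norm_sq, Complex.normSq_apply]
    simp
    ring
  refine (((hVint α hα).add (hVint β hβ)).const_mul ((2 * π)⁻¹ * |β - α|)).mono'
    hcont.aestronglyMeasurable (ae_of_all _ fun t => ?_)
  rw [cauchyKernel, inv_sub_inv (hne α hα t) (hne β hβ t),
    show (β : ℂ) - t * Complex.I - (α - t * Complex.I) = ((β - α : ℝ) : ℂ) by push_cast; ring,
    norm_mul, norm_div, norm_inv, Complex.norm_real, Complex.norm_real,
    Real.norm_of_nonneg (by positivity : 0 ≤ 2 * π), norm_mul, Real.norm_eq_abs, mul_assoc, div_eq_mul_inv]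
  refine mul_le_mul_of_nonneg_left (mul_le_mul_of_nonneg_left ?_ (abs_nonneg _)) (by positivity)
  simp only [Pi.add_apply]
  rw [← hsq, ← hsq, mul_inv, ← inv_pow, ← inv_pow]
  have h1 : 0 ≤ ‖(α : ℂ) - t * Complex.I‖⁻¹ := by positivity
  have h2 : 0 ≤ ‖(β : ℂ) - t * Complex.I‖⁻¹ := by positivity
  nlinarith [sq_nonneg (‖(α : ℂ) - t * Complex.I‖⁻¹ - ‖(β : ℂ) - t * Complex.I‖⁻¹)]

lemma fourier_cauchyKernel {α β : ℝ} (hα : 0 < α) (hβ : 0 < β) :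
    𝓕 (cauchyKernel α β) = halfLineSymbol α β := by
  rw [← fourierInv_halfLineSymbol hα hβ]
  refine (continuous_halfLineSymbol α β).fourier_fourierInv_eq (integrable_halfLineSymbol hα hβ) ?_
  have h := (integrable_cauchyKernel hα hβ).comp_neg
  refine h.congr (ae_of_all _ fun x => ?_)
  simp only
  rw [← fourierInv_halfLineSymbol hα hβ, Real.fourierInv_eq_fourier_neg, neg_neg]

lemma exists_lintegral_cauchyKernel_conv_rpow_le {q : ℝ} (hq : 1 < q) :
    ∃ K : ℝ≥0, ∀ α β : ℝ, 0 < α → 0 < β → ∀ f : ℝ → ℂ, Measurable f → ∀ M, (∀ t, ‖f t‖ ≤ M) →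
      ∫⁻ x, ‖∫ t, cauchyKernel α β t * f (x - t)‖ₑ ^ q ≤ K * ∫⁻ t, ‖f t‖ₑ ^ q := by
  have hq0 : 0 < q := by linarith
  obtain ⟨K, hK⟩ := exists_lintegral_cauchyOp_rpow_le hq
  refine ⟨2 ^ (q - 1) * (K + K), fun α β hα hβ f hf M hM => ?_⟩
  set g : ℕ → ℝ → ℂ := fun n => (Icc (-(n : ℝ)) n).indicator f with hg
  have hgle (n : ℕ) (t : ℝ) : ‖g n t‖ ≤ ‖f t‖ := norm_indicator_le_norm_self _ _
  have hgB (n : ℕ) : BddSupp (g n) :=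
    ⟨hf.indicator measurableSet_Icc, ⟨M, fun t => (hgle n t).trans (hM t)⟩,
      ⟨n, by positivity, fun t ht => indicator_of_notMem ht _⟩⟩
  have hconv (n : ℕ) (x : ℝ) : ∫ t, cauchyKernel α β t * g n (x - t) =
      ((2 * π : ℝ) : ℂ)⁻¹ * (cauchyOp α (g n) x - cauchyOp β (g n) x) := by
    rw [← integral_sub_left_eq_self _ _ x, cauchyOp, cauchyOp, ← integral_sub
      (integrable_mul_cauchyKernel hα (hgB n).integrable x)
      (integrable_mul_cauchyKernel hβ (hgB n).integrable x), ← integral_const_mul]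
    refine integral_congr_ae (ae_of_all _ fun t => ?_)
    simp only [cauchyKernel, sub_sub_cancel]
    push_cast
    ring
  have hc (n : ℕ) (γ : ℝ) (hγ : 0 < γ) : Measurable (cauchyOp γ (g n)) :=
    (continuous_cauchyOp hγ (hgB n).integrable).measurable
  have hpi : ‖((2 * π : ℝ) : ℂ)⁻¹‖ₑ ≤ 1 := by
    rw [← ofReal_norm, norm_inv, Complex.norm_real, Real.norm_of_nonneg (by positivity)]
    refine ENNReal.ofReal_le_one.2 (inv_le_one_of_one_le₀ ?_)
    linarith [Real.pi_gt_three]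
  have hbound (n : ℕ) : ∫⁻ x, ‖∫ t, cauchyKernel α β t * g n (x - t)‖ₑ ^ q ≤
      ((2 ^ (q - 1) * (K + K) : ℝ≥0) : ℝ≥0∞) * ∫⁻ t, ‖f t‖ₑ ^ q := by
    calc ∫⁻ x, ‖∫ t, cauchyKernel α β t * g n (x - t)‖ₑ ^ q
        ≤ ∫⁻ x, (2 : ℝ≥0∞) ^ (q - 1) * (‖cauchyOp α (g n) x‖ₑ ^ q
            + ‖cauchyOp β (g n) x‖ₑ ^ q) := by
          refine lintegral_mono fun x => ?_
          rw [hconv, enorm_mul]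
          refine (ENNReal.rpow_le_rpow ((mul_le_mul_left hpi _).trans
            ((one_mul _).trans_le enorm_sub_le)) hq0.le).trans ?_
          exact ENNReal.rpow_add_le_mul_rpow_add_rpow _ _ hq.le
      _ = (2 : ℝ≥0∞) ^ (q - 1) * ((∫⁻ x, ‖cauchyOp α (g n) x‖ₑ ^ q)
            + ∫⁻ x, ‖cauchyOp β (g n) x‖ₑ ^ q) := by
          have h1 := hc n α hα
          have h2 := hc n β hβ
          rw [lintegral_const_mul _ (by fun_prop), lintegral_add_left (by fun_prop)]
      _ ≤ (2 : ℝ≥0∞) ^ (q - 1) * ((K * ∫⁻ t, ‖f t‖ₑ ^ q) + K * ∫⁻ t, ‖f t‖ₑ ^ q) := by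
          have hle : ∫⁻ t, ‖g n t‖ₑ ^ q ≤ ∫⁻ t, ‖f t‖ₑ ^ q := lintegral_mono fun t =>
            ENNReal.rpow_le_rpow (enorm_le_iff_norm_le.2 (hgle n t)) hq0.le
          gcongr
          · exact (hK α hα _ (hgB n)).trans (mul_le_mul_right hle _)
          · exact (hK β hβ _ (hgB n)).trans (mul_le_mul_right hle _)
      _ = _ := by
          push_cast
          rw [ENNReal.coe_rpow_of_nonneg _ (by linarith), ← add_mul, mul_assoc]
          simp
  have hlim (x : ℝ) : Tendsto (fun n => ∫ t, cauchyKernel α β t * g n (x - t)) atTop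
      (𝓝 (∫ t, cauchyKernel α β t * f (x - t))) := by
    have hkm := (integrable_cauchyKernel hα hβ)
    refine tendsto_integral_of_dominated_convergence (fun t => ‖cauchyKernel α β t‖ * M) ?_
      (hkm.norm.mul_const M) ?_ ?_
    · intro n
      refine hkm.aestronglyMeasurable.mul (Measurable.aestronglyMeasurable ?_)
      exact (hgB n).measurable.comp (measurable_const.sub measurable_id)
    · refine fun n => ae_of_all _ fun t => ?_
      rw [norm_mul]
      gcongr
      exact (hgle n _).trans (hM _)
    · refine ae_of_all _ fun t => ?_
      refine tendsto_const_nhds.congr' ?_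
      filter_upwards [eventually_ge_atTop ⌈|x - t|⌉₊] with n hn
      rw [hg]
      simp only
      rw [indicator_of_mem]
      exact abs_le.1 (Nat.ceil_le.1 hn)
  calc ∫⁻ x, ‖∫ t, cauchyKernel α β t * f (x - t)‖ₑ ^ q
      = ∫⁻ x, liminf (fun n => ‖∫ t, cauchyKernel α β t * g n (x - t)‖ₑ ^ q) atTop := by
        refine lintegral_congr fun x => ?_
        exact (((ENNReal.continuous_rpow_const.tendsto _).comp
          ((continuous_enorm.tendsto _).comp (hlim x))).liminf_eq).symm
    _ ≤ liminf (fun n => ∫⁻ x, ‖∫ t, cauchyKernel α β t * g n (x - t)‖ₑ ^ q) atTop := by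
        refine lintegral_liminf_le fun n => ?_
        simp only [hconv]
        have h1 := hc n α hα
        have h2 := hc n β hβ
        fun_prop
    _ ≤ _ := by
        refine liminf_le_of_le (by isBoundedDefault) fun b hb => ?_
        obtain ⟨n, hn⟩ := hb.exists
        exact hn.trans (hbound n)

/-! ### One-sided multipliers in a coordinate direction -/

lemma continuous_fourierInv {d : ℕ} {V : Rd d → ℂ} (hV : Integrable V) : Continuous (𝓕⁻ V) := by
  have h : 𝓕⁻ V = fun x => 𝓕 V (-x) := funext fun x => Real.fourierInv_eq_fourier_neg V x
  rw [h]
  exact (VectorFourier.fourierIntegral_continuous Real.continuous_fourierChar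
    (innerSL ℝ).continuous₂ hV).comp continuous_neg

lemma continuous_euclideanSpace_single {d : ℕ} (i : Fin d) :
    Continuous fun t : ℝ => (EuclideanSpace.single i t : Rd d) :=
  (PiLp.continuous_toLp 2 _).comp (continuous_single (A := fun _ : Fin d => ℝ) i)

lemma norm_fourierInv_le {d : ℕ} (V : Rd d → ℂ) (x : Rd d) : ‖𝓕⁻ V x‖ ≤ ∫ ξ, ‖V ξ‖ := by
  rw [Real.fourierInv_eq]
  refine (norm_integral_le_integral_norm _).trans (le_of_eq ?_)
  simp

lemma measurable_cauchyKernel (α β : ℝ) : Measurable (cauchyKernel α β) := by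
  unfold cauchyKernel
  fun_prop

lemma lintegral_le_of_forall_update {d : ℕ} (i : Fin d) {f g : (Fin d → ℝ) → ℝ≥0∞}
    (hf : Measurable f) (hg : Measurable g)
    (h : ∀ x, ∫⁻ y, f (Function.update x i y) ≤ ∫⁻ y, g (Function.update x i y)) :
    ∫⁻ x, f x ≤ ∫⁻ x, g x := by
  rw [volume_pi, lintegral_eq_lmarginal_univ 0, lintegral_eq_lmarginal_univ 0,
    lmarginal_erase' f hf (Finset.mem_univ i), lmarginal_erase' g hg (Finset.mem_univ i)]
  exact lmarginal_mono h 0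

lemma lintegral_ofLp {d : ℕ} (f : Rd d → ℝ≥0∞) :
    ∫⁻ x, f x = ∫⁻ y : Fin d → ℝ, f (WithLp.toLp 2 y) :=
  ((PiLp.volume_preserving_toLp (Fin d)).lintegral_comp_emb
    (MeasurableEquiv.toLp 2 (Fin d → ℝ)).measurableEmbedding f).symm

lemma exists_lintegral_conv_coord_rpow_le {q : ℝ} (hq : 1 < q) (d : ℕ) :
    ∃ K : ℝ≥0, ∀ α β : ℝ, 0 < α → 0 < β → ∀ (i : Fin d) (f : Rd d → ℂ), Continuous f →
      ∀ M, (∀ t, ‖f t‖ ≤ M) →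
      ∫⁻ x, ‖∫ t, cauchyKernel α β t * f (x - EuclideanSpace.single i t)‖ₑ ^ q ≤
        K * ∫⁻ x, ‖f x‖ₑ ^ q := by
  obtain ⟨K, hK⟩ := exists_lintegral_cauchyKernel_conv_rpow_le hq
  refine ⟨K, fun α β hα hβ i f hf M hM => ?_⟩
  have hsingle := continuous_euclideanSpace_single i
  have hfm : Measurable fun y : Fin d → ℝ => ‖f (WithLp.toLp 2 y)‖ₑ ^ q := by
    have := (hf.comp (PiLp.continuous_toLp 2 _)).measurable
    exact (this.enorm).pow_const q
  have hm : Measurable fun x : Rd d =>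
      ∫ t, cauchyKernel α β t * f (x - EuclideanSpace.single i t) := by
    refine StronglyMeasurable.measurable (StronglyMeasurable.integral_prod_right ?_)
    refine Measurable.stronglyMeasurable ?_
    refine ((measurable_cauchyKernel α β).comp measurable_snd).mul (Continuous.measurable ?_)
    exact hf.comp (continuous_fst.sub (hsingle.comp continuous_snd))
  rw [lintegral_ofLp, lintegral_ofLp, ← lintegral_const_mul _ hfm]
  refine lintegral_le_of_forall_update i ?_ (hfm.const_mul _) fun x => ?_
  · exact ((hm.comp (PiLp.continuous_toLp 2 _).measurable).enorm).pow_const q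
  · have hup : Continuous fun y => (WithLp.toLp 2 (Function.update x i y) : Rd d) :=
      (PiLp.continuous_toLp 2 _).comp (continuous_const.update i continuous_id)
    have key := hK α β hα hβ (fun y => f (WithLp.toLp 2 (Function.update x i y)))
      (hf.comp hup).measurable M fun t => hM _
    have hfu : Measurable fun y => ‖f (WithLp.toLp 2 (Function.update x i y))‖ₑ ^ q :=
      (hf.comp hup).measurable.enorm.pow_const q
    rw [lintegral_const_mul _ hfu]
    refine le_trans (le_of_eq ?_) key
    refine lintegral_congr fun y => ?_
    congr 3
    funext t
    congr 2
    ext j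
    by_cases hj : j = i
    · subst hj; simp
    · simp [hj]

lemma fourierInv_halfLineSymbol_coord_mul {α β : ℝ} (hα : 0 < α) (hβ : 0 < β) {d : ℕ} (i : Fin d)
    {V : Rd d → ℂ} (hV : Integrable V) (x : Rd d) :
    𝓕⁻ (fun ξ => halfLineSymbol α β (ξ i) * V ξ) x =
      ∫ t, cauchyKernel α β t * 𝓕⁻ V (x - EuclideanSpace.single i t) := by
  have hsingle := continuous_euclideanSpace_single i
  have hl (ξ : Rd d) : 𝐞 (inner ℝ ξ x) • (halfLineSymbol α β (ξ i) * V ξ) =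
      ∫ t, cauchyKernel α β t * (𝐞 (inner ℝ ξ (x - EuclideanSpace.single i t)) • V ξ) := by
    rw [← fourier_cauchyKernel hα hβ, Real.fourier_eq, ← integral_mul_const, Circle.smul_def,
      smul_eq_mul, ← integral_const_mul]
    refine integral_congr_ae (ae_of_all _ fun t => ?_)
    have he : inner ℝ ξ (x - EuclideanSpace.single i t) = inner ℝ ξ x + -inner ℝ t (ξ i) := by
      rw [inner_sub_right, EuclideanSpace.inner_single_right, sub_eq_add_neg]
      simp [mul_comm]
    simp only [he, Circle.smul_def, smul_eq_mul, AddChar.map_add_eq_mul, Circle.coe_mul]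
    ring
  have hr (t : ℝ) : cauchyKernel α β t * 𝓕⁻ V (x - EuclideanSpace.single i t) =
      ∫ ξ, cauchyKernel α β t * (𝐞 (inner ℝ ξ (x - EuclideanSpace.single i t)) • V ξ) := by
    rw [Real.fourierInv_eq, integral_const_mul]
  rw [Real.fourierInv_eq]
  simp only [hl, hr]
  refine integral_integral_swap ?_
  have hVint : Integrable (fun z : Rd d × ℝ => V z.1 * cauchyKernel α β z.2)
    (volume.prod volume) := hV.mul_prod (integrable_cauchyKernel hα hβ)
  have hc : Continuous fun z : Rd d × ℝ =>
      ((𝐞 (inner ℝ z.1 (x - EuclideanSpace.single i z.2)) : Circle) : ℂ) := by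
    refine continuous_induced_dom.comp (Real.continuous_fourierChar.comp ?_)
    exact continuous_fst.inner (continuous_const.sub (hsingle.comp continuous_snd))
  refine (hVint.bdd_mul (c := 1) hc.aestronglyMeasurable
    (ae_of_all _ fun z => (Circle.norm_coe _).le)).congr
    (ae_of_all _ fun z => ?_)
  simp only [Function.uncurry_def, Circle.smul_def, smul_eq_mul]
  ring

/-- One-sided exponential symbols: `e^{-s|ξ|}` on `ξ > 0` for `σ = true` and on `ξ ≤ 0` for
`σ = false`. -/
def halfExp (σ : Bool) (s ξ : ℝ) : ℂ := if (σ = true ↔ 0 < ξ) then (Real.exp (-(s * |ξ|)) : ℂ) else 0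

lemma measurable_halfExp (σ : Bool) (s : ℝ) : Measurable (halfExp σ s) := by
  refine Measurable.ite ?_ (by fun_prop) measurable_const
  cases σ
  · exact (measurableSet_Iic (a := (0 : ℝ))).congr (by ext; simp)
  · exact (measurableSet_Ioi (a := (0 : ℝ))).congr (by ext; simp)

lemma norm_halfExp_le (σ : Bool) {s : ℝ} (hs : 0 ≤ s) (ξ : ℝ) : ‖halfExp σ s ξ‖ ≤ 1 := by
  unfold halfExp
  split_ifs
  · rw [Complex.norm_real, Real.norm_of_nonneg (by positivity)]
    exact Real.exp_le_one_iff.2 (neg_nonpos.2 (by positivity))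
  · simp

lemma Integrable.halfExp_coord_mul {d : ℕ} (i : Fin d) (σ : Bool) {s : ℝ} (hs : 0 ≤ s)
    {V : Rd d → ℂ} (hV : Integrable V) : Integrable fun ξ => halfExp σ s (ξ i) * V ξ := by
  refine hV.bdd_mul (c := 1) (Measurable.aestronglyMeasurable ?_)
    (ae_of_all _ fun ξ => norm_halfExp_le σ hs _)
  exact (measurable_halfExp σ s).comp (by fun_prop)

lemma tendsto_halfLineSymbol (s ξ : ℝ) :
    Tendsto (fun n : ℕ => halfLineSymbol (s / (2 * π) + 1 / ((n : ℝ) + 1)) ((n : ℝ) + 1) ξ) atTop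
      (𝓝 (halfExp true s ξ)) := by
  by_cases hξ : 0 < ξ
  · have h1 : Tendsto (fun n : ℕ => -(2 * π * (s / (2 * π) + 1 / ((n : ℝ) + 1)) * ξ)) atTop
        (𝓝 (-(s * ξ))) := by
      have := (((tendsto_one_div_add_atTop_nhds_zero_nat (𝕜 := ℝ)).const_add
        (s / (2 * π))).const_mul (2 * π)).mul_const ξ
      convert this.neg using 3
      field_simp
      ring
    have h2 : Tendsto (fun n : ℕ => -(2 * π * ((n : ℝ) + 1) * ξ)) atTop atBot := by
      refine tendsto_neg_atTop_atBot.comp ?_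
      refine Tendsto.atTop_mul_const hξ (Tendsto.const_mul_atTop (by positivity) ?_)
      exact tendsto_atTop_add_const_right _ _ tendsto_natCast_atTop_atTop
    have h3 := (((Real.continuous_exp.tendsto _).comp h1).sub (Real.tendsto_exp_atBot.comp h2))
    have h4 := (Complex.continuous_ofReal.tendsto _).comp h3
    convert h4 using 2
    · simp [halfLineSymbol, max_eq_left hξ.le]
    · simp [halfExp, hξ, abs_of_pos hξ]
  · simp [halfLineSymbol_of_nonpos _ _ (not_lt.1 hξ), halfExp, hξ]

lemma exists_lintegral_fourierInv_halfExp_true_le {q : ℝ} (hq : 1 < q) (d : ℕ) :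
    ∃ K : ℝ≥0, ∀ s : ℝ, 0 ≤ s → ∀ (i : Fin d) (V : Rd d → ℂ), Integrable V →
      ∫⁻ x, ‖𝓕⁻ (fun ξ => halfExp true s (ξ i) * V ξ) x‖ₑ ^ q ≤ K * ∫⁻ x, ‖𝓕⁻ V x‖ₑ ^ q := by
  obtain ⟨K, hK⟩ := exists_lintegral_conv_coord_rpow_le hq d
  refine ⟨K, fun s hs i V hV => ?_⟩
  set κ : ℕ → ℝ → ℂ := fun n => halfLineSymbol (s / (2 * π) + 1 / ((n : ℝ) + 1)) ((n : ℝ) + 1)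
    with hκ
  have hpos1 (n : ℕ) : 0 < s / (2 * π) + 1 / ((n : ℝ) + 1) := by positivity
  have hpos2 (n : ℕ) : 0 < (n : ℝ) + 1 := by positivity
  have hκm (n : ℕ) : AEStronglyMeasurable (fun ξ : Rd d => κ n (ξ i)) := by
    refine Continuous.aestronglyMeasurable ?_
    exact (continuous_halfLineSymbol _ _).comp (by fun_prop)
  have hκb (n : ℕ) (ξ : ℝ) : ‖κ n ξ‖ ≤ 2 := norm_halfLineSymbol_le (hpos1 n) (hpos2 n) ξ
  have hbound (n : ℕ) : ∫⁻ x, ‖𝓕⁻ (fun ξ => κ n (ξ i) * V ξ) x‖ₑ ^ q ≤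
      K * ∫⁻ x, ‖𝓕⁻ V x‖ₑ ^ q := by
    simp only [hκ, fourierInv_halfLineSymbol_coord_mul (hpos1 n) (hpos2 n) i hV]
    exact hK _ _ (hpos1 n) (hpos2 n) i _ (continuous_fourierInv hV) _ (norm_fourierInv_le V)
  have hlim (x : Rd d) : Tendsto (fun n => 𝓕⁻ (fun ξ => κ n (ξ i) * V ξ) x) atTop
      (𝓝 (𝓕⁻ (fun ξ => halfExp true s (ξ i) * V ξ) x)) := by
    simp only [Real.fourierInv_eq']
    have hc : Continuous fun v : Rd d => Complex.exp (↑(2 * π * inner ℝ v x) * Complex.I) := by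
      fun_prop
    refine tendsto_integral_of_dominated_convergence (fun ξ => 2 * ‖V ξ‖)
      (fun n => hc.aestronglyMeasurable.smul ((hκm n).mul hV.aestronglyMeasurable))
      (hV.norm.const_mul 2) (fun n => ae_of_all _ fun ξ => ?_) (ae_of_all _ fun ξ => ?_)
    · rw [norm_smul, Complex.norm_exp_ofReal_mul_I, one_mul, norm_mul]
      exact mul_le_mul_of_nonneg_right (hκb n _) (norm_nonneg _)
    · exact ((tendsto_halfLineSymbol s (ξ i)).mul_const _).const_smul _
  calc ∫⁻ x, ‖𝓕⁻ (fun ξ => halfExp true s (ξ i) * V ξ) x‖ₑ ^ q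
      = ∫⁻ x, liminf (fun n => ‖𝓕⁻ (fun ξ => κ n (ξ i) * V ξ) x‖ₑ ^ q) atTop := by
        refine lintegral_congr fun x => ?_
        exact (((ENNReal.continuous_rpow_const.tendsto _).comp
          ((continuous_enorm.tendsto _).comp (hlim x))).liminf_eq).symm
    _ ≤ liminf (fun n => ∫⁻ x, ‖𝓕⁻ (fun ξ => κ n (ξ i) * V ξ) x‖ₑ ^ q) atTop := by
        refine lintegral_liminf_le fun n => ?_
        have := (continuous_fourierInv (hV.bdd_mul (hκm n)
          (ae_of_all _ fun ξ => hκb n (ξ i)))).measurable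
        exact this.enorm.pow_const q
    _ ≤ _ := by
        refine liminf_le_of_le (by isBoundedDefault) fun b hb => ?_
        obtain ⟨n, hn⟩ := hb.exists
        exact hn.trans (hbound n)

lemma fourierInv_comp_neg {d : ℕ} (V : Rd d → ℂ) (x : Rd d) :
    𝓕⁻ (fun ξ => V (-ξ)) x = 𝓕⁻ V (-x) :=
  Real.fourierInv_comp_linearIsometry (LinearIsometryEquiv.neg ℝ) V x

lemma ae_coord_ne_zero {d : ℕ} (i : Fin d) : ∀ᵐ ξ : Rd d, ξ i ≠ 0 :=
  (PiLp.volume_preserving_ofLp (Fin d)).quasiMeasurePreserving.ae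
    (Measure.ae_eval_ne (μ := fun _ : Fin d => (volume : Measure ℝ)) i 0)

lemma halfExp_neg (s : ℝ) {ξ : ℝ} (hξ : ξ ≠ 0) : halfExp true s (-ξ) = halfExp false s ξ := by
  have : ξ ≤ 0 ↔ ξ < 0 := ⟨fun h => lt_of_le_of_ne h hξ, le_of_lt⟩
  simp [halfExp, this]

lemma exists_lintegral_fourierInv_halfExp_le {q : ℝ} (hq : 1 < q) (d : ℕ) :
    ∃ K : ℝ≥0, ∀ (σ : Bool) (s : ℝ), 0 ≤ s → ∀ (i : Fin d) (V : Rd d → ℂ), Integrable V →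
      ∫⁻ x, ‖𝓕⁻ (fun ξ => halfExp σ s (ξ i) * V ξ) x‖ₑ ^ q ≤ K * ∫⁻ x, ‖𝓕⁻ V x‖ₑ ^ q := by
  obtain ⟨K, hK⟩ := exists_lintegral_fourierInv_halfExp_true_le hq d
  refine ⟨K, fun σ s hs i V hV => ?_⟩
  cases σ
  · have h := hK s hs i (fun ξ => V (-ξ)) hV.comp_neg
    simp only [fourierInv_comp_neg] at h
    rw [lintegral_neg_eq_self (fun x => ‖𝓕⁻ V x‖ₑ ^ q)] at h
    refine le_trans (le_of_eq ?_) h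
    rw [← lintegral_neg_eq_self]
    refine lintegral_congr fun x => ?_
    rw [← fourierInv_comp_neg]
    congr 2
    rw [Real.fourierInv_eq, Real.fourierInv_eq]
    refine integral_congr_ae ?_
    filter_upwards [ae_coord_ne_zero i] with ξ hξ
    rw [← halfExp_neg s (by simpa using hξ)]
    simp
  · exact hK s hs i V hV

/-! ### Products of one-sided multipliers -/

/-- The tensor product of the one-sided exponential symbols `halfExp (σ i) (s i)`. -/
def prodExp {d : ℕ} (σ : Fin d → Bool) (s : Fin d → ℝ) (ξ : Rd d) : ℂ :=
  ∏ i, halfExp (σ i) (s i) (ξ i)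

lemma measurable_prodExp {d : ℕ} (σ : Fin d → Bool) (s : Fin d → ℝ) :
    Measurable (prodExp σ s) :=
  Finset.measurable_fun_prod _ fun i _ => (measurable_halfExp (σ i) (s i)).comp (by fun_prop)

lemma norm_prodExp_le {d : ℕ} (σ : Fin d → Bool) {s : Fin d → ℝ} (hs : ∀ i, 0 ≤ s i) (ξ : Rd d) :
    ‖prodExp σ s ξ‖ ≤ 1 := by
  rw [prodExp, norm_prod]
  exact Finset.prod_le_one (fun i _ => norm_nonneg _) fun i _ => norm_halfExp_le _ (hs i) _

lemma Integrable.prodExp_mul {d : ℕ} (σ : Fin d → Bool) {s : Fin d → ℝ} (hs : ∀ i, 0 ≤ s i)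
    {V : Rd d → ℂ} (hV : Integrable V) : Integrable fun ξ => prodExp σ s ξ * V ξ :=
  hV.bdd_mul (measurable_prodExp σ s).aestronglyMeasurable
    (ae_of_all _ fun ξ => norm_prodExp_le σ hs ξ)

lemma exists_eLpNorm_fourierInv_prodExp_le {q : ℝ} (hq : 1 < q) (d : ℕ) :
    ∃ A : ℝ≥0, ∀ (σ : Fin d → Bool) (s : Fin d → ℝ), (∀ i, 0 ≤ s i) → ∀ V : Rd d → ℂ,
      Integrable V → eLpNorm (𝓕⁻ fun ξ => prodExp σ s ξ * V ξ) (ENNReal.ofReal q) volume ≤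
        A * eLpNorm (𝓕⁻ V) (ENNReal.ofReal q) volume := by
  have hq0 : 0 < q := by linarith
  obtain ⟨K, hK⟩ := exists_lintegral_fourierInv_halfExp_le hq d
  refine ⟨(K ^ d) ^ (1 / q), fun σ s hs V hV => ?_⟩
  have key (S : Finset (Fin d)) :
      Integrable (fun ξ : Rd d => (∏ i ∈ S, halfExp (σ i) (s i) (ξ i)) * V ξ) ∧
      ∫⁻ x, ‖𝓕⁻ (fun ξ => (∏ i ∈ S, halfExp (σ i) (s i) (ξ i)) * V ξ) x‖ₑ ^ q ≤
        K ^ S.card * ∫⁻ x, ‖𝓕⁻ V x‖ₑ ^ q := by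
    induction S using Finset.induction_on with
    | empty => simpa using hV
    | insert i S hi ih =>
      simp only [Finset.prod_insert hi, mul_assoc, Finset.card_insert_of_notMem hi]
      refine ⟨Integrable.halfExp_coord_mul i (σ i) (hs i) ih.1, ?_⟩
      refine (hK (σ i) (s i) (hs i) i _ ih.1).trans ?_
      rw [pow_succ', mul_assoc]
      exact mul_le_mul_right ih.2 _
  have h := (key Finset.univ).2
  rw [Finset.card_univ, Fintype.card_fin] at h
  rw [eLpNorm_eq_lintegral_rpow_enorm_toReal (by simpa using hq0) ENNReal.ofReal_ne_top,
    eLpNorm_eq_lintegral_rpow_enorm_toReal (by simpa using hq0) ENNReal.ofReal_ne_top,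
    ENNReal.toReal_ofReal hq0.le]
  refine (ENNReal.rpow_le_rpow h (by positivity)).trans (le_of_eq ?_)
  rw [ENNReal.mul_rpow_of_nonneg _ _ (by positivity), ENNReal.coe_rpow_of_nonneg _ (by positivity),
    ENNReal.coe_pow]

/-- The decay rate of the factor with sign `σ'` when the output frequency has sign `σ`. -/
def signGap (σ σ' : Bool) : ℝ := if σ = σ' then 0 else 2

lemma signGap_nonneg (σ σ' : Bool) : 0 ≤ signGap σ σ' := by
  unfold signGap; split_ifs <;> norm_num

lemma exp_abs_add_sub_eq_sum (τ a b : ℝ) :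
    (Real.exp (τ * |a + b|) * (Real.exp (-τ * |a|) * Real.exp (-τ * |b|)) : ℂ) =
      ∑ r : Bool × Bool × Bool, halfExp r.2.2 0 (a + b) *
        (halfExp r.1 (τ * signGap r.2.2 r.1) a * halfExp r.2.1 (τ * signGap r.2.2 r.2.1) b) := by
  simp only [Fintype.sum_prod_type, Fintype.sum_bool]
  rcases lt_or_ge 0 a with ha | ha <;> rcases lt_or_ge 0 b with hb | hb <;>
    rcases lt_or_ge 0 (a + b) with hc | hc <;>
    simp only [halfExp, ha, hb, hc, not_lt.2, signGap, abs_of_pos, abs_of_nonpos] <;>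
    simp [← Complex.exp_add] <;> try ring_nf
  all_goals first | linarith | simp

lemma exp_neg_mul_abs_eq_sum (τ a : ℝ) :
    (Real.exp (-τ * |a|) : ℂ) = ∑ σ : Bool, halfExp σ τ a := by
  rcases lt_or_ge 0 a with ha | ha <;> simp [halfExp, ha, not_lt.2]

lemma exp_mul_sum_eq_prod {d : ℕ} (τ : ℝ) (ξ : Rd d) :
    (Real.exp (τ * ∑ i, |ξ i|) : ℂ) = ∏ i, (Real.exp (τ * |ξ i|) : ℂ) := by
  rw [Finset.mul_sum, Real.exp_sum, Complex.ofReal_prod]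

lemma exp_l1_add_sub_eq_sum {d : ℕ} (τ : ℝ) (ξ η : Rd d) :
    (Real.exp (τ * ∑ i, |(ξ + η) i|) *
        (Real.exp (-τ * ∑ i, |ξ i|) * Real.exp (-τ * ∑ i, |η i|)) : ℂ) =
      ∑ r : Fin d → Bool × Bool × Bool, prodExp (fun i => (r i).2.2) 0 (ξ + η) *
        (prodExp (fun i => (r i).1) (fun i => τ * signGap (r i).2.2 (r i).1) ξ *
          prodExp (fun i => (r i).2.1) (fun i => τ * signGap (r i).2.2 (r i).2.1) η) := by
  simp only [exp_mul_sum_eq_prod, prodExp, ← Finset.prod_mul_distrib]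
  rw [← Fintype.prod_sum (fun (i : Fin d) (r : Bool × Bool × Bool) =>
    halfExp r.2.2 ((0 : Fin d → ℝ) i) ((ξ + η) i) * (halfExp r.1 (τ * signGap r.2.2 r.1) (ξ i) *
      halfExp r.2.1 (τ * signGap r.2.2 r.2.1) (η i)))]
  refine Finset.prod_congr rfl fun i _ => ?_
  exact exp_abs_add_sub_eq_sum τ (ξ i) (η i)

lemma exp_neg_l1_eq_sum {d : ℕ} (τ : ℝ) (ξ : Rd d) :
    (Real.exp (-τ * ∑ i, |ξ i|) : ℂ) = ∑ σ : Fin d → Bool, prodExp σ (fun _ => τ) ξ := by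
  simp only [exp_mul_sum_eq_prod, prodExp]
  rw [← Fintype.prod_sum (fun (i : Fin d) (σ : Bool) => halfExp σ τ (ξ i))]
  exact Finset.prod_congr rfl fun i _ => exp_neg_mul_abs_eq_sum τ (ξ i)

/-! ### The bilinear estimate -/

lemma fourierInv_finset_sum {d : ℕ} {ι : Type*} (S : Finset ι) {V : ι → Rd d → ℂ}
    (hV : ∀ j ∈ S, Integrable (V j)) :
    𝓕⁻ (fun ξ => ∑ j ∈ S, V j ξ) = ∑ j ∈ S, 𝓕⁻ (V j) := by
  funext x
  rw [Finset.sum_apply]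
  simp only [Real.fourierInv_eq, Finset.smul_sum]
  refine integral_finsetSum S fun j hj => ?_
  simpa using (Real.fourierIntegral_convergent_iff (-x)).2 (hV j hj)

open scoped Convolution in
lemma fourierInv_convolution {d : ℕ} {U V : Rd d → ℂ} (hU : Integrable U) (hV : Integrable V)
    (x : Rd d) : 𝓕⁻ (U ⋆[ContinuousLinearMap.mul ℂ ℂ] V) x = 𝓕⁻ U x * 𝓕⁻ V x := by
  simp only [Real.fourierInv_eq_fourier_neg]
  exact Real.fourier_mul_convolution_eq hU hV (-x)

lemma integrable_fourier_schwartz {d : ℕ} (F : 𝓢(Rd d, ℂ)) : Integrable (𝓕 (F : Rd d → ℂ)) := by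
  rw [← SchwartzMap.fourier_coe]
  exact (𝓕 F).integrable

lemma fourierInv_fourier_schwartz {d : ℕ} (F : 𝓢(Rd d, ℂ)) : 𝓕⁻ (𝓕 (F : Rd d → ℂ)) = F :=
  F.continuous.fourierInv_fourier_eq F.integrable (integrable_fourier_schwartz F)

lemma norm_exp_neg_l1_le {d : ℕ} {τ : ℝ} (hτ : 0 ≤ τ) (ξ : Rd d) :
    ‖(Real.exp (-τ * ∑ i, |ξ i|) : ℂ)‖ ≤ 1 := by
  rw [Complex.norm_real, Real.norm_of_nonneg (by positivity)]
  refine Real.exp_le_one_iff.2 ?_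
  rw [neg_mul, neg_nonpos]
  positivity

lemma continuous_exp_l1 {d : ℕ} (τ : ℝ) :
    Continuous fun ξ : Rd d => (Real.exp (τ * ∑ i, |ξ i|) : ℂ) := by
  fun_prop

lemma integrable_exp_neg_l1_mul {d : ℕ} {τ : ℝ} (hτ : 0 ≤ τ) {V : Rd d → ℂ} (hV : Integrable V) :
    Integrable fun ξ => (Real.exp (-τ * ∑ i, |ξ i|) : ℂ) * V ξ :=
  hV.bdd_mul (continuous_exp_l1 (-τ)).aestronglyMeasurable
    (ae_of_all _ fun ξ => norm_exp_neg_l1_le hτ ξ)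

lemma memLp_two_expL1_neg {d : ℕ} {τ : ℝ} (hτ : 0 ≤ τ) (F : 𝓢(Rd d, ℂ)) :
    MemLp (expL1 d (-τ) F) 2 volume := by
  obtain ⟨A, hA⟩ := exists_eLpNorm_fourierInv_prodExp_le one_lt_two d
  have hF := integrable_fourier_schwartz F
  have hVint (σ : Fin d → Bool) :
      Integrable fun ξ : Rd d => prodExp σ (fun _ => τ) ξ * 𝓕 (F : Rd d → ℂ) ξ :=
    Integrable.prodExp_mul σ (fun _ => hτ) hF
  have hsum : expL1 d (-τ) F =
      ∑ σ : Fin d → Bool, 𝓕⁻ (fun ξ => prodExp σ (fun _ => τ) ξ * 𝓕 (F : Rd d → ℂ) ξ) := by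
    rw [← fourierInv_finset_sum _ fun σ _ => hVint σ, expL1]
    simp only [exp_neg_l1_eq_sum, Finset.sum_mul]
  rw [hsum]
  refine memLp_finsetSum' _ fun σ _ =>
    ⟨(continuous_fourierInv (hVint σ)).aestronglyMeasurable, ?_⟩
  have h := hA σ (fun _ => τ) (fun _ => hτ) _ hF
  rw [fourierInv_fourier_schwartz, show ENNReal.ofReal 2 = 2 by norm_num] at h
  exact h.trans_lt (ENNReal.mul_lt_top ENNReal.coe_lt_top (F.memLp 2 volume).2)

open scoped Convolution in
lemma fourier_expL1_neg_mul_expL1_neg {d : ℕ} {τ : ℝ} (hτ : 0 ≤ τ) (F G : 𝓢(Rd d, ℂ)) :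
    𝓕 (fun x => expL1 d (-τ) F x * expL1 d (-τ) G x) =
      (fun ξ => (Real.exp (-τ * ∑ i, |ξ i|) : ℂ) * 𝓕 (F : Rd d → ℂ) ξ)
        ⋆[ContinuousLinearMap.mul ℂ ℂ]
      (fun ξ => (Real.exp (-τ * ∑ i, |ξ i|) : ℂ) * 𝓕 (G : Rd d → ℂ) ξ) := by
  have hU := integrable_exp_neg_l1_mul hτ (integrable_fourier_schwartz F)
  have hV := integrable_exp_neg_l1_mul hτ (integrable_fourier_schwartz G)
  set U := fun ξ : Rd d => (Real.exp (-τ * ∑ i, |ξ i|) : ℂ) * 𝓕 (F : Rd d → ℂ) ξ with hUdef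
  set V := fun ξ : Rd d => (Real.exp (-τ * ∑ i, |ξ i|) : ℂ) * 𝓕 (G : Rd d → ℂ) ξ with hVdef
  have hprod : (fun x => expL1 d (-τ) F x * expL1 d (-τ) G x) =
      𝓕⁻ (U ⋆[ContinuousLinearMap.mul ℂ ℂ] V) :=
    funext fun x => (fourierInv_convolution hU hV x).symm
  have hprodint : Integrable (fun x => expL1 d (-τ) F x * expL1 d (-τ) G x) :=
    (memLp_two_expL1_neg hτ F).integrable_mul (memLp_two_expL1_neg hτ G)
  have hVc : Continuous V := by
    refine (continuous_exp_l1 (-τ)).mul ?_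
    rw [← SchwartzMap.fourier_coe]
    exact (𝓕 G).continuous
  have hVb : BddAbove (range fun ξ => ‖V ξ‖) := by
    refine ⟨∫ x, ‖G x‖, ?_⟩
    rintro _ ⟨ξ, rfl⟩
    have h1 := norm_fourierInv_le (G : Rd d → ℂ) (-ξ)
    rw [Real.fourierInv_eq_fourier_neg, neg_neg] at h1
    simp only [hVdef, norm_mul]
    exact (mul_le_of_le_one_left (norm_nonneg _) (norm_exp_neg_l1_le hτ ξ)).trans h1
  rw [hprod]
  refine Continuous.fourier_fourierInv_eq
    (hVb.continuous_convolution_right_of_integrable _ hU hVc)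
    (hU.integrable_convolution _ hV) ?_
  rw [hprod] at hprodint
  refine hprodint.comp_neg.congr (ae_of_all _ fun x => ?_)
  simp only
  rw [Real.fourierInv_eq_fourier_neg, neg_neg]

open scoped Convolution in
lemma exp_l1_mul_convolution {d : ℕ} {τ : ℝ} (hτ : 0 ≤ τ) {U V : Rd d → ℂ} (hU : Integrable U)
    (hV : Integrable V) {M : ℝ} (hM : ∀ ξ, ‖V ξ‖ ≤ M) (ζ : Rd d) :
    (Real.exp (τ * ∑ i, |ζ i|) : ℂ) *
      ((fun ξ => (Real.exp (-τ * ∑ i, |ξ i|) : ℂ) * U ξ) ⋆[ContinuousLinearMap.mul ℂ ℂ]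
        (fun ξ => (Real.exp (-τ * ∑ i, |ξ i|) : ℂ) * V ξ)) ζ =
    ∑ r : Fin d → Bool × Bool × Bool, prodExp (fun i => (r i).2.2) 0 ζ *
      ((fun ξ => prodExp (fun i => (r i).1) (fun i => τ * signGap (r i).2.2 (r i).1) ξ * U ξ)
        ⋆[ContinuousLinearMap.mul ℂ ℂ]
        (fun ξ => prodExp (fun i => (r i).2.1)
          (fun i => τ * signGap (r i).2.2 (r i).2.1) ξ * V ξ)) ζ := by
  simp only [convolution_def, ContinuousLinearMap.mul_apply', ← integral_const_mul]
  rw [← integral_finsetSum]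
  · refine integral_congr_ae (ae_of_all _ fun t => ?_)
    have h := exp_l1_add_sub_eq_sum τ t (ζ - t)
    rw [add_sub_cancel] at h
    simp only
    calc _ = (Real.exp (τ * ∑ i, |ζ i|) * (Real.exp (-τ * ∑ i, |t i|) *
          Real.exp (-τ * ∑ i, |(ζ - t) i|)) : ℂ) * (U t * V (ζ - t)) := by ring
      _ = _ := by
        rw [h, Finset.sum_mul]
        exact Finset.sum_congr rfl fun r _ => by ring
  · intro r _
    refine Integrable.const_mul ?_ _
    have hs (σ : Fin d → Bool) (i : Fin d) : 0 ≤ τ * signGap (r i).2.2 (σ i) :=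
      mul_nonneg hτ (signGap_nonneg _ _)
    refine (Integrable.prodExp_mul _ (hs _) hU).mul_bdd (c := M) ?_ (ae_of_all _ fun t => ?_)
    · exact ((Integrable.prodExp_mul _ (hs _) hV).comp_sub_left ζ).aestronglyMeasurable
    · rw [norm_mul]
      exact (mul_le_of_le_one_left (norm_nonneg _) (norm_prodExp_le _ (hs _) _)).trans (hM _)

/-- Bilinear Gevrey estimate: for 1 < p, p₁, p₂ < ∞ with 1/p = 1/p₁ + 1/p₂, uniformly
in τ ≥ 0, ‖e^{τΛ₁}(fg)‖_{L^p} ≲ ‖F₀‖_{L^{p₁}}·‖G₀‖_{L^{p₂}} where f = e^{−τΛ₁}F₀ and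
g = e^{−τΛ₁}G₀. -/
theorem gevrey_bilinear_Lp_estimate
    (d : ℕ) (hd : 1 ≤ d) (p p₁ p₂ : ℝ)
    (hp : 1 < p) (hp₁ : 1 < p₁) (hp₂ : 1 < p₂)
    (hhol : 1/p = 1/p₁ + 1/p₂) :
    ∃ C : ℝ, 0 < C ∧ ∀ τ : ℝ, 0 ≤ τ → ∀ F₀ G₀ : 𝓢(Rd d, ℂ),
      eLpNorm
          (expL1 d τ (fun x => expL1 d (-τ) (⇑F₀) x * expL1 d (-τ) (⇑G₀) x))
          (ENNReal.ofReal p) volume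
        ≤ ENNReal.ofReal C * eLpNorm (⇑F₀) (ENNReal.ofReal p₁) volume
            * eLpNorm (⇑G₀) (ENNReal.ofReal p₂) volume := by
  obtain ⟨A, hA⟩ := exists_eLpNorm_fourierInv_prodExp_le hp d
  obtain ⟨A₁, hA₁⟩ := exists_eLpNorm_fourierInv_prodExp_le hp₁ d
  obtain ⟨A₂, hA₂⟩ := exists_eLpNorm_fourierInv_prodExp_le hp₂ d
  have hHT : (ENNReal.ofReal p₁).HolderTriple (ENNReal.ofReal p₂) (ENNReal.ofReal p) := ⟨by
    rw [← ENNReal.ofReal_inv_of_pos (by linarith), ← ENNReal.ofReal_inv_of_pos (by linarith),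
      ← ENNReal.ofReal_inv_of_pos (by linarith), ← ENNReal.ofReal_add (by positivity)
      (by positivity)]
    simp only [one_div] at hhol
    rw [hhol]⟩
  set N : ℝ≥0 := (Fintype.card (Fin d → Bool × Bool × Bool) : ℝ≥0) * (A * (A₁ * A₂)) with hN
  refine ⟨N + 1, by positivity, fun τ hτ F₀ G₀ => ?_⟩
  set F := 𝓕 (F₀ : Rd d → ℂ) with hF
  set G := 𝓕 (G₀ : Rd d → ℂ) with hG
  have hFi : Integrable F := integrable_fourier_schwartz F₀
  have hGi : Integrable G := integrable_fourier_schwartz G₀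
  have hGb (ξ : Rd d) : ‖G ξ‖ ≤ ∫ x, ‖G₀ x‖ := by
    have h := norm_fourierInv_le (G₀ : Rd d → ℂ) (-ξ)
    rwa [Real.fourierInv_eq_fourier_neg, neg_neg] at h
  set U : (Fin d → Bool × Bool × Bool) → Rd d → ℂ := fun r ξ =>
    prodExp (fun i => (r i).1) (fun i => τ * signGap (r i).2.2 (r i).1) ξ * F ξ with hU
  set V : (Fin d → Bool × Bool × Bool) → Rd d → ℂ := fun r ξ =>
    prodExp (fun i => (r i).2.1) (fun i => τ * signGap (r i).2.2 (r i).2.1) ξ * G ξ with hV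
  have hs (r : Fin d → Bool × Bool × Bool) (σ : Fin d → Bool) (i : Fin d) :
      0 ≤ τ * signGap (r i).2.2 (σ i) := mul_nonneg hτ (signGap_nonneg _ _)
  have hUi (r) : Integrable (U r) := Integrable.prodExp_mul _ (hs r _) hFi
  have hVi (r) : Integrable (V r) := Integrable.prodExp_mul _ (hs r _) hGi
  set H : (Fin d → Bool × Bool × Bool) → Rd d → ℂ := fun r =>
    convolution (U r) (V r) (ContinuousLinearMap.mul ℂ ℂ) volume with hH
  have hHi (r) : Integrable (H r) := (hUi r).integrable_convolution _ (hVi r)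
  have hcHi (r) : Integrable fun ζ => prodExp (fun i => (r i).2.2) 0 ζ * H r ζ :=
    Integrable.prodExp_mul _ (fun _ => le_rfl) (hHi r)
  have hsum : expL1 d τ (fun x => expL1 d (-τ) (⇑F₀) x * expL1 d (-τ) (⇑G₀) x) =
      ∑ r, 𝓕⁻ (fun ζ => prodExp (fun i => (r i).2.2) 0 ζ * H r ζ) := by
    rw [← fourierInv_finset_sum _ fun r _ => hcHi r]
    conv_lhs => rw [expL1, fourier_expL1_neg_mul_expL1_neg hτ]
    congr 1
    funext ζ
    exact exp_l1_mul_convolution hτ hFi hGi hGb ζ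
  have hterm (r) : eLpNorm (𝓕⁻ (fun ζ => prodExp (fun i => (r i).2.2) 0 ζ * H r ζ))
      (ENNReal.ofReal p) volume ≤ (A * (A₁ * A₂) : ℝ≥0) *
        (eLpNorm (⇑F₀) (ENNReal.ofReal p₁) volume * eLpNorm (⇑G₀) (ENNReal.ofReal p₂) volume) := by
    have h1 := hA₁ (fun i => (r i).1) _ (hs r fun i => (r i).1) F hFi
    have h2 := hA₂ (fun i => (r i).2.1) _ (hs r fun i => (r i).2.1) G hGi
    rw [hF, fourierInv_fourier_schwartz] at h1
    rw [hG, fourierInv_fourier_schwartz] at h2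
    have hHprod : 𝓕⁻ (H r) = 𝓕⁻ (U r) • 𝓕⁻ (V r) :=
      funext fun x => fourierInv_convolution (hUi r) (hVi r) x
    refine (hA _ 0 (fun _ => le_rfl) _ (hHi r)).trans ?_
    rw [hHprod]
    have h3 := eLpNorm_smul_le_mul_eLpNorm (p := ENNReal.ofReal p₁) (q := ENNReal.ofReal p₂)
      (r := ENNReal.ofReal p) (μ := volume)
      (continuous_fourierInv (hVi r)).aestronglyMeasurable
      (continuous_fourierInv (hUi r)).aestronglyMeasurable
    refine (mul_le_mul_right (h3.trans (mul_le_mul' h1 h2)) _).trans (le_of_eq ?_)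
    push_cast
    ring
  rw [hsum]
  refine (eLpNorm_sum_le (fun r _ => (continuous_fourierInv (hcHi r)).aestronglyMeasurable)
    (ENNReal.one_le_ofReal.2 hp.le)).trans ?_
  refine (Finset.sum_le_sum fun r _ => hterm r).trans ?_
  rw [Finset.sum_const, Finset.card_univ, nsmul_eq_mul, ← mul_assoc, mul_assoc (ENNReal.ofReal _)]
  refine mul_le_mul_left ?_ _
  rw [show ((N : ℝ) + 1) = ((N + 1 : ℝ≥0) : ℝ) by push_cast; ring, ENNReal.ofReal_coe_nnreal, hN]
  push_cast
  exact le_self_add
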